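/- Let p be a prime and H a finite abelian p-group. Let (α_n) be a sequence of positive real numbers such that for every constant Δ > 0, one has α_n ≥ Δ·(log n)/n for all sufficiently large n. For each n and each k,l ∈ {1,…,n}, let μ^{(n)}_{kl} be an α_n-balanced Borel probability measure on Z_p, and let P_n be the product measure on M_n(Z_p) (so the entries are independent, entry (k,l) distributed according to μ^{(n)}_{kl}). Then lim_{n→∞} P_n({A ∈ M_n(Z_p) : cok(A) is isomorphic to H as a Z_p-module}) = (1/|Aut(H)|)·∏_{i=1}^∞ (1 − p^{−i}). -/

import Mathlib

open MeasureTheory Filter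

namespace CokUniv
open scoped Classical

theorem char_bound (p L : ℕ) [Fact p.Prime] : ∃ κ : ℝ, 0 < κ ∧ ∀ (z : ℂ), z ^ (p ^ L) = 1 → z ≠ 1 →
    ∀ (w : ZMod (p ^ L) → ℝ) (a : ℝ), (∀ x, 0 ≤ w x) → ∑ x, w x = 1 →
    (∀ c : ZMod p, ∑ x, (if (x.val : ZMod p) = c then w x else 0) ≤ 1 - a) →
    ‖∑ x, (w x : ℂ) * z ^ x.val‖ ≤ Real.exp (-κ * a) := by
  have hp : p.Prime := Fact.out
  have hpos : 0 < p ^ L := pow_pos hp.pos L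
  obtain ⟨κ, hκ, hκ'⟩ : ∃ κ : ℝ, 0 < κ ∧ ∀ u : ℂ, u ^ (p ^ L) = 1 → u ≠ 1 → u.re ≤ 1 - κ := by
    have hfin : {u : ℂ | u ^ (p ^ L) = 1 ∧ u ≠ 1}.Finite := by
      refine Set.Finite.subset (Polynomial.nthRoots (p ^ L) (1 : ℂ)).toFinset.finite_toSet ?_
      intro u hu
      simp [Polynomial.mem_nthRoots hpos, hu.1]
    have hre : ∀ u ∈ hfin.toFinset, u.re < 1 := by
      intro u hu
      simp only [Set.Finite.mem_toFinset, Set.mem_ofPred_eq] at hu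
      have h1 : ‖u‖ = 1 := Complex.norm_eq_one_of_pow_eq_one hu.1 hpos.ne'
      have h2 : u.re ≤ 1 := h1 ▸ Complex.re_le_norm u
      rcases h2.lt_or_eq with h | h
      · exact h
      · exfalso
        apply hu.2
        have h3 : Complex.normSq u = 1 := by rw [Complex.normSq_eq_norm_sq, h1]; norm_num
        rw [Complex.normSq_apply, h] at h3
        apply Complex.ext
        · simpa using h
        · simp; nlinarith
    rcases hfin.toFinset.eq_empty_or_nonempty with h | h
    · refine ⟨1, one_pos, fun u h1 h2 => ?_⟩
      exfalso
      have : u ∈ hfin.toFinset := by simp [h1, h2]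
      simp [h] at this
    · obtain ⟨u0, hu0, hmax⟩ := Finset.exists_max_image _ Complex.re h
      refine ⟨1 - u0.re, by linarith [hre u0 hu0], fun u h1 h2 => ?_⟩
      have := hmax u (by simp [h1, h2])
      linarith
  refine ⟨κ / 2, by positivity, fun z hz hz1 w a hw hsum hbal => ?_⟩
  have hz0 : ‖z‖ = 1 := Complex.norm_eq_one_of_pow_eq_one hz hpos.ne'
  have hpo : p ∣ orderOf z := by
    have h1 : orderOf z ∣ p ^ L := orderOf_dvd_of_pow_eq_one hz
    obtain ⟨i, hi, hi2⟩ := (Nat.dvd_prime_pow hp).1 h1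
    rw [hi2]
    apply dvd_pow_self
    rintro rfl
    rw [pow_zero, orderOf_eq_one_iff] at hi2
    exact hz1 hi2
  have hconj : ∀ m : ℕ, z ^ m * (starRingEnd ℂ) (z ^ m) = 1 := by
    intro m
    rw [Complex.mul_conj, Complex.normSq_eq_norm_sq, norm_pow, hz0]; norm_num
  have hpair : ∀ x y : ZMod (p ^ L), (z ^ x.val * (starRingEnd ℂ) (z ^ y.val)).re ≤
      1 - κ * (if (y.val : ZMod p) = (x.val : ZMod p) then 0 else 1) := by
    intro x y
    split_ifs with h
    · have := Complex.re_le_norm (z ^ x.val * (starRingEnd ℂ) (z ^ y.val))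
      rw [norm_mul, RCLike.norm_conj, norm_pow, norm_pow, hz0] at this
      simpa using this
    · rw [mul_one]
      apply hκ'
      · rw [mul_pow, ← map_pow, ← pow_mul, ← pow_mul, mul_comm x.val, mul_comm y.val, pow_mul,
          pow_mul, hz]; simp
      · intro h1
        apply h
        have h2 : z ^ x.val = z ^ y.val := by
          have := congrArg (· * z ^ y.val) h1
          simp only [one_mul] at this
          rw [mul_assoc, mul_comm ((starRingEnd ℂ) _), hconj, mul_one] at this
          exact this
        have hfo : IsOfFinOrder z := isOfFinOrder_iff_pow_eq_one.2 ⟨_, hpos, hz⟩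
        rw [hfo.pow_eq_pow_iff_modEq] at h2
        have h3 := h2.of_dvd hpo
        exact ((ZMod.natCast_eq_natCast_iff _ _ _).2 h3).symm
  set S : ℂ := ∑ x, (w x : ℂ) * z ^ x.val with hS
  have hsq : ‖S‖ ^ 2 = ∑ x, ∑ y, w x * w y * (z ^ x.val * (starRingEnd ℂ) (z ^ y.val)).re := by
    have : ((‖S‖ ^ 2 : ℝ) : ℂ) = S * (starRingEnd ℂ) S := by
      rw [Complex.mul_conj, Complex.normSq_eq_norm_sq]
    have h2 := congrArg Complex.re this
    rw [Complex.ofReal_re] at h2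
    rw [h2, hS, map_sum, Finset.sum_mul_sum, Complex.re_sum]
    refine Finset.sum_congr rfl fun x _ => ?_
    rw [Complex.re_sum]
    refine Finset.sum_congr rfl fun y _ => ?_
    rw [map_mul, Complex.conj_ofReal, ← Complex.re_ofReal_mul]
    congr 1
    push_cast; ring
  have hle : ‖S‖ ^ 2 ≤ 1 - κ * a := by
    rw [hsq]
    calc _ ≤ ∑ x, ∑ y, w x * w y * (1 - κ * (if (y.val : ZMod p) = (x.val : ZMod p) then 0 else 1)) := by
          refine Finset.sum_le_sum fun x _ => Finset.sum_le_sum fun y _ => ?_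
          exact mul_le_mul_of_nonneg_left (hpair x y) (mul_nonneg (hw x) (hw y))
      _ = ∑ x, w x * (1 - κ * (1 - ∑ y, (if (y.val : ZMod p) = (x.val : ZMod p) then w y else 0))) := by
          refine Finset.sum_congr rfl fun x _ => ?_
          have e1 : (1 : ℝ) - κ * (1 - ∑ y, (if (y.val : ZMod p) = (x.val : ZMod p) then w y else 0))
            = ∑ y, w y * (1 - κ * (if (y.val : ZMod p) = (x.val : ZMod p) then 0 else 1)) := by
            have e2 : ∀ y, w y * (1 - κ * (if (y.val : ZMod p) = (x.val : ZMod p) then 0 else 1))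
              = w y - κ * (w y - (if (y.val : ZMod p) = (x.val : ZMod p) then w y else 0)) := by
              intro y; split_ifs <;> ring
            simp_rw [e2]
            rw [Finset.sum_sub_distrib, ← Finset.mul_sum, Finset.sum_sub_distrib, hsum]
          rw [e1, Finset.mul_sum]
          refine Finset.sum_congr rfl fun y _ => ?_
          ring
      _ ≤ ∑ x, w x * (1 - κ * a) := by
          refine Finset.sum_le_sum fun x _ => ?_
          apply mul_le_mul_of_nonneg_left _ (hw x)
          have := hbal (x.val : ZMod p)
          nlinarith
      _ = 1 - κ * a := by rw [← Finset.sum_mul, hsum, one_mul]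
  have h4 : ‖S‖ ^ 2 ≤ (Real.exp (-(κ / 2) * a)) ^ 2 := by
    rw [← Real.exp_nat_mul]
    have := Real.add_one_le_exp (-(κ * a))
    calc _ ≤ Real.exp (-(κ * a)) := by linarith
      _ = _ := by congr 1; push_cast; ring
  exact le_of_sq_le_sq h4 (Real.exp_pos _).le |> fun h => h

/-- column probability -/
noncomputable def colP {q n : ℕ} [NeZero q] (w : Fin n → Fin n → ZMod q → ℝ) (l : Fin n)
    (s : Set (Fin n → ZMod q)) : ℝ :=
  ∑ x : Fin n → ZMod q, if x ∈ s then ∏ k, w k l (x k) else 0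

/-- matrix probability -/
noncomputable def matP {q n : ℕ} [NeZero q] (w : Fin n → Fin n → ZMod q → ℝ)
    (E : (Fin n → Fin n → ZMod q) → Prop) : ℝ :=
  ∑ A : Fin n → Fin n → ZMod q, if E A then ∏ k, ∏ l, w k l (A k l) else 0

theorem matP_cols {q n : ℕ} [NeZero q] (w : Fin n → Fin n → ZMod q → ℝ)
    (s : Set (Fin n → ZMod q)) :
    matP w (fun A => ∀ l, (fun k => A k l) ∈ s) = ∏ l, colP w l s := by
  unfold matP colP
  rw [Finset.prod_univ_sum, Fintype.piFinset_univ]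
  refine Fintype.sum_equiv (Equiv.piComm _) _ _ fun A => ?_
  simp only [Equiv.piComm_apply]
  by_cases h : ∀ l, (fun k => A k l) ∈ s
  · rw [if_pos h, Finset.prod_comm]
    refine Finset.prod_congr rfl fun l _ => ?_
    have := h l
    rw [if_pos]
    exact this
  · rw [if_neg h]
    push Not at h
    obtain ⟨l, hl⟩ := h
    symm
    apply Finset.prod_eq_zero (Finset.mem_univ l)
    rw [if_neg]
    exact hl

/-- kernel of evaluation on a tuple -/
def kerS {q n : ℕ} {G : Type*} [AddCommGroup G] [Module (ZMod q) G] (g : Fin n → G) :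
    Set (Fin n → ZMod q) := {x | ∑ i, x i • g i = 0}

theorem char_smul {q : ℕ} [NeZero q] {G : Type*} [AddCommGroup G] [Module (ZMod q) G]
    (χ : AddChar G ℂ) (a : ZMod q) (g : G) : χ (a • g) = χ g ^ a.val := by
  rw [← AddChar.map_nsmul_eq_pow]
  congr 1
  conv_lhs => rw [← ZMod.natCast_zmod_val a]
  rw [Nat.cast_smul_eq_nsmul]

theorem char_sum {G ι : Type*} [AddCommGroup G] (χ : AddChar G ℂ) (s : Finset ι) (f : ι → G) :
    χ (∑ i ∈ s, f i) = ∏ i ∈ s, χ (f i) := by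
  induction s using Finset.induction_on with
  | empty => simp
  | insert a s ha ih => rw [Finset.sum_insert ha, Finset.prod_insert ha, AddChar.map_add_eq_mul, ih]

theorem colP_formula {q n : ℕ} [NeZero q] {G : Type*} [AddCommGroup G] [Module (ZMod q) G]
    [Fintype G] (w : Fin n → Fin n → ZMod q → ℝ) (l : Fin n) (g : Fin n → G) :
    (Fintype.card G : ℂ) * (colP w l (kerS g) : ℂ) =
      ∑ χ : AddChar G ℂ, ∏ k, ∑ a : ZMod q, (w k l a : ℂ) * χ (g k) ^ a.val := by
  have h1 : ∀ χ : AddChar G ℂ, ∏ k, ∑ a : ZMod q, (w k l a : ℂ) * χ (g k) ^ a.val =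
      ∑ x : Fin n → ZMod q, (∏ k, (w k l (x k) : ℂ)) * χ (∑ i, x i • g i) := by
    intro χ
    rw [Finset.prod_univ_sum, Fintype.piFinset_univ]
    refine Finset.sum_congr rfl fun x _ => ?_
    rw [char_sum, ← Finset.prod_mul_distrib]
    refine Finset.prod_congr rfl fun k _ => ?_
    rw [char_smul]
  simp_rw [h1]
  rw [Finset.sum_comm]
  unfold colP
  push_cast
  rw [Finset.mul_sum]
  refine Finset.sum_congr rfl fun x _ => ?_
  rw [← Finset.mul_sum, AddChar.sum_apply_eq_ite]
  by_cases h : ∑ i, x i • g i = 0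
  · have h' : x ∈ kerS g := h
    rw [if_pos h', if_pos h]; push_cast; ring
  · have h' : x ∉ kerS g := h
    rw [if_neg h', if_neg h]; simp

/-- weight of a character -/
noncomputable def supp {n : ℕ} {G : Type*} [AddCommGroup G] (g : Fin n → G) (χ : AddChar G ℂ) :
    Finset (Fin n) := Finset.univ.filter fun i => χ (g i) ≠ 1

/-- admissible weights -/
structure Adm (p L : ℕ) [NeZero (p ^ L)] {n : ℕ} (w : Fin n → Fin n → ZMod (p ^ L) → ℝ) (a : ℝ) : Prop where
  nonneg : ∀ k l x, 0 ≤ w k l x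
  sum : ∀ k l, ∑ x, w k l x = 1
  bal : ∀ k l (c : ZMod p), ∑ x, (if (x.val : ZMod p) = c then w k l x else 0) ≤ 1 - a

theorem prod_char_bound (p L : ℕ) [Fact p.Prime] : ∃ κ : ℝ, 0 < κ ∧ ∀ (G : Type) [AddCommGroup G]
    [Module (ZMod (p ^ L)) G] [Fintype G] (n : ℕ) (w : Fin n → Fin n → ZMod (p ^ L) → ℝ) (a : ℝ),
    Adm p L w a → ∀ (g : Fin n → G) (χ : AddChar G ℂ) (l : Fin n),
    ‖∏ k, ∑ a : ZMod (p ^ L), (w k l a : ℂ) * χ (g k) ^ a.val‖ ≤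
      Real.exp (-(κ * a * (supp g χ).card)) := by
  obtain ⟨κ, hκ, h⟩ := char_bound p L
  refine ⟨κ, hκ, fun G _ _ _ n w a hw g χ l => ?_⟩
  have hroot : ∀ k, χ (g k) ^ (p ^ L) = 1 := by
    intro k
    rw [← AddChar.map_nsmul_eq_pow, ← Nat.cast_smul_eq_nsmul (ZMod (p ^ L)), ZMod.natCast_self]
    simp
  rw [norm_prod]
  calc _ ≤ ∏ k, (if χ (g k) ≠ 1 then Real.exp (-κ * a) else 1) := by
        refine Finset.prod_le_prod (fun _ _ => norm_nonneg _) fun k _ => ?_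
        split_ifs with h1
        · exact h _ (hroot k) h1 _ a (hw.nonneg k l) (hw.sum k l) (hw.bal k l)
        · push Not at h1
          rw [h1]
          simp only [one_pow, mul_one]
          rw [← Complex.ofReal_sum, hw.sum]; simp
    _ = _ := by
        rw [← Finset.prod_filter, Finset.prod_const, ← Real.exp_nat_mul]
        unfold supp
        congr 1; ring

theorem colP_nonneg {p L n : ℕ} [NeZero (p ^ L)] {w : Fin n → Fin n → ZMod (p ^ L) → ℝ} {a : ℝ}
    (hw : Adm p L w a) (l : Fin n) (s : Set (Fin n → ZMod (p ^ L))) : 0 ≤ colP w l s := by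
  unfold colP
  refine Finset.sum_nonneg fun x _ => ?_
  split_ifs
  · exact Finset.prod_nonneg fun k _ => hw.nonneg _ _ _
  · exact le_rfl

theorem card_triv_on {G : Type*} [AddCommGroup G] [Fintype G] (K : AddSubgroup G) :
    (Finset.univ.filter fun χ : AddChar G ℂ => ∀ k ∈ K, χ k = 1).card * Nat.card K
      = Fintype.card G := by
  have h : ∑ k : K, ∑ χ : AddChar G ℂ, χ (k : G) = (Fintype.card G : ℂ) := by
    simp_rw [AddChar.sum_apply_eq_ite]
    rw [Finset.sum_eq_single (0 : K)]
    · simp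
    · intro b _ hb
      rw [if_neg]
      simpa using hb
    · simp
  rw [Finset.sum_comm] at h
  have h2 : ∀ χ : AddChar G ℂ, ∑ k : K, χ (k : G) =
      if (∀ k ∈ K, χ k = 1) then (Nat.card K : ℂ) else 0 := by
    intro χ
    have := AddChar.sum_eq_ite (χ.compAddMonoidHom K.subtype)
    simp only [AddChar.compAddMonoidHom_apply, AddSubgroup.coe_subtype] at this
    rw [this, Nat.card_eq_fintype_card]
    congr 1
    rw [eq_iff_iff]
    constructor
    · intro h0 k hk
      have := DFunLike.congr_fun h0 ⟨k, hk⟩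
      simpa using this
    · intro h0
      ext k
      simpa using h0 k k.2
  simp_rw [h2] at h
  rw [← Finset.sum_filter, Finset.sum_const, nsmul_eq_mul] at h
  exact_mod_cast h

end CokUniv


namespace CokUniv
open scoped Classical

section
variable {p L n : ℕ} [NeZero (p ^ L)] {G : Type} [AddCommGroup G] [Module (ZMod (p ^ L)) G] [Fintype G]

/-- abstract character bound -/
def CB (w : Fin n → Fin n → ZMod (p ^ L) → ℝ) (g : Fin n → G) (c : ℝ) : Prop :=
  ∀ (χ : AddChar G ℂ) (l : Fin n), ‖∏ k, ∑ a : ZMod (p ^ L), (w k l a : ℂ) * χ (g k) ^ a.val‖ ≤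
      Real.exp (-(c * (supp g χ).card))

theorem card_mul_colP_le {w : Fin n → Fin n → ZMod (p ^ L) → ℝ} {g : Fin n → G} {c : ℝ}
    (h : CB w g c) (l : Fin n) :
    (Fintype.card G : ℝ) * colP w l (kerS g) ≤ ∑ χ : AddChar G ℂ, Real.exp (-(c * (supp g χ).card)) := by
  have h1 := colP_formula w l g
  have h2 : (Fintype.card G : ℝ) * colP w l (kerS g) ≤
      ‖(Fintype.card G : ℂ) * (colP w l (kerS g) : ℂ)‖ := by
    have : ((Fintype.card G : ℂ) * (colP w l (kerS g) : ℂ)) =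
      (((Fintype.card G : ℝ) * colP w l (kerS g) : ℝ) : ℂ) := by push_cast; rfl
    rw [this, Complex.norm_real]
    exact le_abs_self _
  refine h2.trans ?_
  rw [h1]
  exact (norm_sum_le _ _).trans (Finset.sum_le_sum fun χ _ => h χ l)

theorem abs_card_mul_colP_sub_le {a : ℝ} {w : Fin n → Fin n → ZMod (p ^ L) → ℝ} (hw : Adm p L w a)
    {g : Fin n → G} {c : ℝ} (h : CB w g c) (l : Fin n) :
    ‖(Fintype.card G : ℝ) * colP w l (kerS g) - 1‖ ≤
      ∑ χ ∈ (Finset.univ : Finset (AddChar G ℂ)).erase 0, Real.exp (-(c * (supp g χ).card)) := by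
  have h1 := colP_formula w l g
  have : (((Fintype.card G : ℝ) * colP w l (kerS g) - 1 : ℝ) : ℂ) =
      ∑ χ ∈ (Finset.univ : Finset (AddChar G ℂ)).erase 0,
        ∏ k, ∑ a : ZMod (p ^ L), (w k l a : ℂ) * χ (g k) ^ a.val := by
    push_cast
    rw [h1, ← Finset.add_sum_erase _ _ (Finset.mem_univ (0 : AddChar G ℂ))]
    have : ∏ k, ∑ a : ZMod (p ^ L), (w k l a : ℂ) * (0 : AddChar G ℂ) (g k) ^ a.val = 1 := by
      apply Finset.prod_eq_one
      intro k _
      simp only [AddChar.zero_apply, one_pow, mul_one]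
      rw [← Complex.ofReal_sum, hw.sum]; simp
    rw [this]; ring
  rw [← Complex.norm_real, this]
  exact (norm_sum_le _ _).trans (Finset.sum_le_sum fun χ _ => h χ l)

theorem good_bound {a : ℝ} {w : Fin n → Fin n → ZMod (p ^ L) → ℝ} (hw : Adm p L w a)
    {g : Fin n → G} {c t : ℝ} (hc : 0 ≤ c) (h : CB w g c)
    (ht : ∀ χ : AddChar G ℂ, χ ≠ 0 → t ≤ (supp g χ).card) :
    |∏ l, colP w l (kerS g) - ((Fintype.card G : ℝ) ^ n)⁻¹| ≤
      ((Fintype.card G : ℝ) ^ n)⁻¹ * (Real.exp (n * (Fintype.card G * Real.exp (-(c * t)))) - 1) := by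
  set M : ℝ := (Fintype.card G : ℝ) with hM
  have hMpos : 0 < M := by
    rw [hM]; exact_mod_cast Fintype.card_pos
  have h1 : ∀ l, ‖M * colP w l (kerS g) - 1‖ ≤ M * Real.exp (-(c * t)) := by
    intro l
    refine (abs_card_mul_colP_sub_le hw h l).trans ?_
    calc _ ≤ ∑ χ ∈ (Finset.univ : Finset (AddChar G ℂ)).erase 0, Real.exp (-(c * t)) := by
          refine Finset.sum_le_sum fun χ hχ => ?_
          apply Real.exp_le_exp.2
          have := ht χ (Finset.ne_of_mem_erase hχ)
          nlinarith
      _ ≤ ∑ χ : AddChar G ℂ, Real.exp (-(c * t)) := by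
          apply Finset.sum_le_sum_of_subset_of_nonneg (Finset.erase_subset _ _)
          intros; positivity
      _ = _ := by
          rw [Finset.sum_const, Finset.card_univ, AddChar.card_eq, nsmul_eq_mul]
  have h2 : ∏ l, colP w l (kerS g) - (M ^ n)⁻¹ =
      (M ^ n)⁻¹ * (∏ l, (1 + (M * colP w l (kerS g) - 1)) - 1) := by
    have : ∏ l, (1 + (M * colP w l (kerS g) - 1)) = M ^ n * ∏ l, colP w l (kerS g) := by
      simp only [add_sub_cancel]
      rw [Finset.prod_mul_distrib, Finset.prod_const]; simp
    rw [this]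
    field_simp
  rw [h2, abs_mul, abs_of_nonneg (by positivity : 0 ≤ (M ^ n)⁻¹)]
  apply mul_le_mul_of_nonneg_left _ (by positivity)
  rw [← Real.norm_eq_abs]
  refine (Finset.norm_prod_one_add_sub_one_le _ _).trans ?_
  apply sub_le_sub_right
  apply Real.exp_le_exp.2
  refine (Finset.sum_le_sum fun l _ => h1 l).trans ?_
  rw [Finset.sum_const, nsmul_eq_mul]; simp

/-- the basic quantity -/
noncomputable def Bq (M c t : ℝ) (s : ℕ) : ℝ :=
  1 - (1 / M) * (1 - Real.exp (-(c * s / M))) + M * Real.exp (-(c * t))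

theorem bad_bound {a : ℝ} {w : Fin n → Fin n → ZMod (p ^ L) → ℝ} (hw : Adm p L w a)
    {g : Fin n → G} {c t : ℝ} (hc : 0 ≤ c) (h : CB w g c) (K : AddSubgroup G)
    (ht : ∀ χ : AddChar G ℂ, (¬ ∀ k ∈ K, χ k = 1) → t ≤ (supp g χ).card) (s : ℕ)
    (hex : ∃ χ : AddChar G ℂ, χ ≠ 0 ∧ (∀ k ∈ K, χ k = 1) ∧
      (s : ℝ) ≤ Fintype.card G * (supp g χ).card) :
    |∏ l, colP w l (kerS g) - ((Fintype.card G : ℝ) ^ n)⁻¹| ≤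
      2 * (((Nat.card K : ℝ) ^ n)⁻¹ * Bq (Fintype.card G) c t s ^ n) := by
  obtain ⟨χ0, hχ0, htriv, hs⟩ := hex
  have hcard := card_triv_on K
  set D := Finset.univ.filter fun χ : AddChar G ℂ => ∀ k ∈ K, χ k = 1 with hD
  set M : ℝ := (Fintype.card G : ℝ) with hM
  have hMpos : 0 < M := by
    rw [hM]; exact_mod_cast Fintype.card_pos
  have hK : 0 < (Nat.card K : ℝ) := by exact_mod_cast Nat.card_pos
  have hcardR : (D.card : ℝ) * (Nat.card K : ℝ) = M := by rw [hM]; exact_mod_cast hcard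
  have hd2 : (2 : ℝ) ≤ D.card := by
    have : 1 < D.card := by
      rw [Finset.one_lt_card]
      exact ⟨χ0, by simp [hD]; exact htriv, 0, by simp [hD], hχ0⟩
    exact_mod_cast this
  have hdM : (D.card : ℝ) ≤ M := by
    rw [← hcardR]
    have : (1 : ℝ) ≤ Nat.card K := by exact_mod_cast Nat.card_pos
    nlinarith
  set e := Real.exp (-(c * s / M)) with he
  have he0 : 0 < e := Real.exp_pos _
  have he1 : e ≤ 1 := by
    rw [he]; apply Real.exp_le_one_iff.2
    have : 0 ≤ c * s / M := by positivity
    linarith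
  set ε := Real.exp (-(c * t)) with hε
  have hε0 : 0 < ε := Real.exp_pos _
  have hcol : ∀ l, colP w l (kerS g) ≤ (Nat.card K : ℝ)⁻¹ * Bq M c t s := by
    intro l
    have h1 := card_mul_colP_le h l
    have hle1 : ∀ χ : AddChar G ℂ, Real.exp (-(c * (supp g χ).card)) ≤ 1 := by
      intro χ
      apply Real.exp_le_one_iff.2
      have : 0 ≤ c * (supp g χ).card := by positivity
      linarith
    have h2 : ∑ χ ∈ D, Real.exp (-(c * (supp g χ).card)) ≤ D.card - 1 + e := by
      rw [← Finset.add_sum_erase D _ (by simp [hD]; exact htriv : χ0 ∈ D)]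
      have h3 : Real.exp (-(c * (supp g χ0).card)) ≤ e := by
        apply Real.exp_le_exp.2
        apply neg_le_neg
        rw [div_le_iff₀ hMpos]
        nlinarith
      have h4 : ∑ χ ∈ D.erase χ0, Real.exp (-(c * (supp g χ).card)) ≤ D.card - 1 := by
        refine (Finset.sum_le_sum fun χ _ => hle1 χ).trans ?_
        rw [Finset.sum_const, Finset.card_erase_of_mem (by simp [hD]; exact htriv), nsmul_eq_mul,
          Nat.cast_sub (by have : (1:ℝ) ≤ D.card := by linarith
                           exact_mod_cast this)]
        simp
      linarith
    have h5 : ∑ χ ∈ Dᶜ, Real.exp (-(c * (supp g χ).card)) ≤ M * ε := by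
      calc _ ≤ ∑ χ ∈ Dᶜ, ε := by
            refine Finset.sum_le_sum fun χ hχ => ?_
            apply Real.exp_le_exp.2
            have := ht χ (by simpa [hD] using hχ)
            nlinarith
        _ ≤ ∑ χ : AddChar G ℂ, ε := by
          apply Finset.sum_le_sum_of_subset_of_nonneg (Finset.subset_univ _)
          intros; positivity
        _ = _ := by
          rw [Finset.sum_const, Finset.card_univ, AddChar.card_eq, nsmul_eq_mul]
    rw [← Finset.sum_add_sum_compl D] at h1
    have h6 : M * colP w l (kerS g) ≤ D.card - 1 + e + M * ε := by linarith
    have h7 : (Nat.card K : ℝ)⁻¹ = D.card / M := by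
      rw [← hcardR]; field_simp
    rw [h7]
    unfold Bq
    rw [← he, ← hε]
    have h8 : colP w l (kerS g) ≤ (D.card - 1 + e + M * ε) / M := by
      rw [le_div_iff₀ hMpos]; linarith
    refine h8.trans ?_
    rw [div_mul_eq_mul_div]
    apply div_le_div_of_nonneg_right _ hMpos.le
    have h9 : (D.card : ℝ) * (1 / M) * (1 - e) ≤ 1 - e := by
      have : (D.card : ℝ) * (1 / M) ≤ 1 := by rw [mul_one_div, div_le_one hMpos]; exact hdM
      nlinarith
    have h10 : M * ε ≤ D.card * (M * ε) := by
      have : 0 < M * ε := by positivity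
      nlinarith
    nlinarith
  have hA : ∏ l, colP w l (kerS g) ≤ ((Nat.card K : ℝ) ^ n)⁻¹ * Bq M c t s ^ n := by
    calc _ ≤ ∏ l : Fin n, ((Nat.card K : ℝ)⁻¹ * Bq M c t s) :=
          Finset.prod_le_prod (fun l _ => colP_nonneg hw l _) fun l _ => hcol l
      _ = _ := by
          rw [Finset.prod_const, mul_pow, inv_pow]; simp
  have hA0 : 0 ≤ ∏ l, colP w l (kerS g) := Finset.prod_nonneg fun l _ => colP_nonneg hw l _
  have hB : (M ^ n)⁻¹ ≤ ((Nat.card K : ℝ) ^ n)⁻¹ * Bq M c t s ^ n := by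
    rw [← inv_pow, ← inv_pow, ← mul_pow]
    apply pow_le_pow_left₀ (by positivity)
    have hb : (1 : ℝ) / 2 ≤ Bq M c t s := by
      unfold Bq
      rw [← he, ← hε]
      have : 1 / M ≤ 1 / 2 := by
        apply one_div_le_one_div_of_le (by norm_num); linarith
      have h0 : 0 < M * ε := by positivity
      have h00 : 0 < 1 / M := by positivity
      nlinarith
    have h7 : (Nat.card K : ℝ)⁻¹ = D.card / M := by
      rw [← hcardR]; field_simp
    rw [h7, div_mul_eq_mul_div, inv_eq_one_div]
    apply div_le_div_of_nonneg_right _ hMpos.le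
    nlinarith
  have hB0 : 0 ≤ (M ^ n)⁻¹ := by positivity
  rw [abs_le]
  constructor <;> linarith

theorem exists_S {g : Fin n → G} (hg : AddSubgroup.closure (Set.range g) = ⊤) {t : ℝ} (ht : 0 ≤ t) :
    ∃ (S : Finset (Fin n)) (K : AddSubgroup G), (S.card : ℝ) ≤ Fintype.card G * t ∧
      (∀ i ∉ S, g i ∈ K) ∧
      (∀ χ : AddChar G ℂ, (¬ ∀ k ∈ K, χ k = 1) → t ≤ (supp g χ).card) ∧
      (S = ∅ → K = ⊤) ∧
      (S.Nonempty → ∃ χ : AddChar G ℂ, χ ≠ 0 ∧ (∀ k ∈ K, χ k = 1) ∧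
      (S.card : ℝ) ≤ Fintype.card G * (supp g χ).card) := by
  set Low := Finset.univ.filter fun χ : AddChar G ℂ => χ ≠ 0 ∧ ((supp g χ).card : ℝ) < t with hLow
  set S := Low.biUnion (supp g) with hS
  set K := AddSubgroup.closure (g '' (Sᶜ : Set (Fin n))) with hK
  have hLc : (Low.card : ℝ) ≤ Fintype.card G := by
    have : Low.card ≤ Fintype.card (AddChar G ℂ) := Finset.card_le_univ _
    rw [AddChar.card_eq] at this
    exact_mod_cast this
  have hScard : (S.card : ℝ) ≤ ∑ χ ∈ Low, ((supp g χ).card : ℝ) := by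
    exact_mod_cast Finset.card_biUnion_le
  have htriv : ∀ χ ∈ Low, ∀ k ∈ K, χ k = 1 := by
    intro χ hχ k hk
    induction hk using AddSubgroup.closure_induction with
    | mem x hx =>
      obtain ⟨i, hi, rfl⟩ := hx
      by_contra h
      apply hi
      simp only [Finset.mem_coe, hS, Finset.mem_biUnion]
      exact ⟨χ, hχ, by simp [supp, h]⟩
    | zero => simp
    | add x y _ _ hx hy => rw [AddChar.map_add_eq_mul, hx, hy, one_mul]
    | neg x _ hx => rw [AddChar.map_neg_eq_inv, hx, inv_one]
  refine ⟨S, K, ?_, ?_, ?_, ?_, ?_⟩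
  · refine hScard.trans ?_
    calc _ ≤ ∑ χ ∈ Low, t := by
          refine Finset.sum_le_sum fun χ hχ => ?_
          simp only [hLow, Finset.mem_filter] at hχ
          exact hχ.2.2.le
      _ = Low.card * t := by rw [Finset.sum_const, nsmul_eq_mul]
      _ ≤ _ := mul_le_mul_of_nonneg_right hLc ht
  · intro i hi
    apply AddSubgroup.subset_closure
    exact ⟨i, by simpa using hi, rfl⟩
  · intro χ hχ
    by_contra h
    push Not at h
    apply hχ
    apply htriv
    simp only [hLow, Finset.mem_filter, Finset.mem_univ, true_and]
    refine ⟨?_, h⟩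
    rintro rfl
    simp at hχ
  · intro h
    rw [hK, h]
    simpa using hg
  · intro hne
    have hLne : Low.Nonempty := by
      rw [Finset.nonempty_iff_ne_empty]
      intro h
      rw [hS, h] at hne
      simp at hne
    obtain ⟨χ, hχ, hmax⟩ := Finset.exists_max_image Low (fun χ => (supp g χ).card) hLne
    refine ⟨χ, ?_, htriv χ hχ, hScard.trans ?_⟩
    · simp only [hLow, Finset.mem_filter] at hχ
      exact hχ.2.1
    · calc _ ≤ ∑ χ' ∈ Low, ((supp g χ).card : ℝ) := by
            refine Finset.sum_le_sum fun χ' hχ' => ?_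
            exact_mod_cast hmax χ' hχ'
        _ = Low.card * (supp g χ).card := by rw [Finset.sum_const, nsmul_eq_mul]
        _ ≤ _ := mul_le_mul_of_nonneg_right hLc (by positivity)

theorem count_gK (S : Finset (Fin n)) (K : AddSubgroup G) :
    (Finset.univ.filter fun g : Fin n → G => ∀ i ∉ S, g i ∈ K).card =
      Nat.card K ^ (n - S.card) * Fintype.card G ^ S.card := by
  have : (Finset.univ.filter fun g : Fin n → G => ∀ i ∉ S, g i ∈ K) =
      Fintype.piFinset (fun i => if i ∈ S then Finset.univ else Finset.univ.filter (· ∈ K)) := by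
    ext g
    simp only [Finset.mem_filter, Finset.mem_univ, true_and, Fintype.mem_piFinset]
    refine forall_congr' fun i => ?_
    by_cases h : i ∈ S <;> simp [h]
  rw [this, Fintype.card_piFinset]
  have h2 : ∀ i, (if i ∈ S then (Finset.univ : Finset G) else Finset.univ.filter (· ∈ K)).card =
      if i ∈ S then Fintype.card G else Nat.card K := by
    intro i
    split_ifs
    · simp
    · rw [Nat.card_eq_fintype_card, Fintype.card_subtype]
  simp_rw [h2]
  rw [Finset.prod_ite]
  simp only [Finset.prod_const]
  rw [mul_comm]
  congr 2
  · have : (Finset.univ.filter fun i => i ∉ S) = Sᶜ := by ext; simp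
    rw [this, Finset.card_compl, Fintype.card_fin]
  · congr 1; ext; simp

/-- The moment error. -/
noncomputable def Err (G : Type) [AddCommGroup G] [Module (ZMod (p ^ L)) G] [Fintype G]
    (w : Fin n → Fin n → ZMod (p ^ L) → ℝ) : ℝ :=
  ∑ g ∈ Finset.univ.filter (fun g : Fin n → G => AddSubgroup.closure (Set.range g) = ⊤),
    |∏ l, colP w l (kerS g) - ((Fintype.card G : ℝ) ^ n)⁻¹|

theorem Err_le {a : ℝ} {w : Fin n → Fin n → ZMod (p ^ L) → ℝ} (hw : Adm p L w a)
    {c t : ℝ} (hc : 0 ≤ c) (ht : 0 ≤ t) (h : ∀ g : Fin n → G, CB w g c) :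
    Err G w ≤ (Real.exp (n * (Fintype.card G * Real.exp (-(c * t)))) - 1) +
      2 * Fintype.card (AddSubgroup G) * ∑ s ∈ Finset.range (n + 1),
        if (1 ≤ s ∧ (s : ℝ) ≤ Fintype.card G * t) then
          (n.choose s) * (Fintype.card G : ℝ) ^ s * Bq (Fintype.card G) c t s ^ n else 0 := by
  set M : ℝ := (Fintype.card G : ℝ) with hM
  have hM1 : 1 ≤ M := by
    rw [hM]; exact_mod_cast Fintype.card_pos
  have hMpos : 0 < M := by linarith
  have hBq : ∀ s, 0 ≤ Bq M c t s := by
    intro s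
    unfold Bq
    have h1 : 1 / M ≤ 1 := by rw [div_le_one hMpos]; exact hM1
    have h2 : 0 < 1 / M := by positivity
    have h3 : 0 < M * Real.exp (-(c * t)) := by positivity
    have h4 := Real.exp_pos (-(c * s / M))
    nlinarith
  set X : ℝ := (Real.exp (n * (M * Real.exp (-(c * t)))) - 1) with hX
  have hX0 : 0 ≤ X := by
    rw [hX, sub_nonneg]
    apply Real.one_le_exp
    positivity
  set f : ℕ → ℝ := fun s => if (1 ≤ s ∧ (s : ℝ) ≤ M * t) then Bq M c t s ^ n else 0 with hf
  have hf0 : ∀ s, 0 ≤ f s := by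
    intro s; simp only [hf]; split_ifs
    · exact pow_nonneg (hBq s) n
    · exact le_rfl
  set Y : (Fin n → G) → Finset (Fin n) → AddSubgroup G → ℝ := fun g S K =>
    if ∀ i ∉ S, g i ∈ K then 2 * (((Nat.card K : ℝ) ^ n)⁻¹ * f S.card) else 0 with hY
  have hY0 : ∀ g S K, 0 ≤ Y g S K := by
    intro g S K
    simp only [hY]
    split_ifs
    · have := hf0 S.card
      positivity
    · exact le_rfl
  have hterm : ∀ g ∈ Finset.univ.filter (fun g : Fin n → G => AddSubgroup.closure (Set.range g) = ⊤),
      |∏ l, colP w l (kerS g) - (M ^ n)⁻¹| ≤ (M ^ n)⁻¹ * X +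
        ∑ S ∈ (Finset.univ : Finset (Fin n)).powerset, ∑ K : AddSubgroup G, Y g S K := by
    intro g hg
    simp only [Finset.mem_filter, Finset.mem_univ, true_and] at hg
    obtain ⟨S, K, hS1, hS2, hS3, hS4, hS5⟩ := exists_S hg ht
    have hsum0 : 0 ≤ ∑ S ∈ (Finset.univ : Finset (Fin n)).powerset, ∑ K : AddSubgroup G, Y g S K :=
      Finset.sum_nonneg fun S _ => Finset.sum_nonneg fun K _ => hY0 g S K
    rcases S.eq_empty_or_nonempty with hS | hS
    · have hK := hS4 hS
      have := good_bound hw hc (h g) (t := t) (by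
        intro χ hχ
        apply hS3
        intro hh
        apply hχ
        ext x
        simpa using hh x (by rw [hK]; trivial))
      linarith
    · have h1 := bad_bound hw hc (h g) K hS3 S.card (hS5 hS)
      have h2 : Y g S K = 2 * (((Nat.card K : ℝ) ^ n)⁻¹ * Bq M c t S.card ^ n) := by
        simp only [hY, hf]
        rw [if_pos hS2, if_pos ⟨hS.card_pos, hS1⟩]
      have h3 : Y g S K ≤ ∑ S ∈ (Finset.univ : Finset (Fin n)).powerset, ∑ K : AddSubgroup G, Y g S K := by
        refine le_trans ?_ (Finset.single_le_sum (f := fun S => ∑ K : AddSubgroup G, Y g S K)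
          (fun S _ => Finset.sum_nonneg fun K _ => hY0 g S K) (by simp : S ∈ _))
        exact Finset.single_le_sum (f := fun K => Y g S K) (fun K _ => hY0 g S K) (Finset.mem_univ K)
      have h4 : 0 ≤ (M ^ n)⁻¹ * X := by positivity
      linarith
  have hYsum : ∀ (S : Finset (Fin n)) (K : AddSubgroup G), ∑ g, Y g S K ≤ 2 * (M ^ S.card * f S.card) := by
    intro S K
    simp only [hY]
    rw [← Finset.sum_filter, Finset.sum_const, nsmul_eq_mul, count_gK]
    push_cast
    have hk : (1 : ℝ) ≤ Nat.card K := by exact_mod_cast Nat.card_pos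
    have hle : S.card ≤ n := by simpa using Finset.card_le_univ S
    have h1 : (Nat.card K : ℝ) ^ (n - S.card) * ((Nat.card K : ℝ) ^ n)⁻¹ ≤ 1 := by
      rw [← div_eq_mul_inv, div_le_one (by positivity)]
      exact pow_le_pow_right₀ hk (Nat.sub_le _ _)
    have h2 : 0 ≤ M ^ S.card * f S.card := mul_nonneg (by positivity) (hf0 _)
    calc _ = ((Nat.card K : ℝ) ^ (n - S.card) * ((Nat.card K : ℝ) ^ n)⁻¹) * (2 * (M ^ S.card * f S.card)) := by
          ring
      _ ≤ 1 * (2 * (M ^ S.card * f S.card)) := mul_le_mul_of_nonneg_right h1 (by positivity)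
      _ = _ := one_mul _
  unfold Err
  calc _ ≤ ∑ g : Fin n → G, ((M ^ n)⁻¹ * X +
        ∑ S ∈ (Finset.univ : Finset (Fin n)).powerset, ∑ K : AddSubgroup G, Y g S K) := by
        refine (Finset.sum_le_sum hterm).trans ?_
        apply Finset.sum_le_sum_of_subset_of_nonneg (Finset.filter_subset _ _)
        intro g _ _
        have h1 : 0 ≤ ∑ S ∈ (Finset.univ : Finset (Fin n)).powerset, ∑ K : AddSubgroup G, Y g S K :=
          Finset.sum_nonneg fun S _ => Finset.sum_nonneg fun K _ => hY0 g S K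
        have h4 : 0 ≤ (M ^ n)⁻¹ * X := by positivity
        linarith
    _ = X + ∑ S ∈ (Finset.univ : Finset (Fin n)).powerset, ∑ K : AddSubgroup G, ∑ g, Y g S K := by
        rw [Finset.sum_add_distrib]
        congr 1
        · rw [Finset.sum_const, nsmul_eq_mul]
          simp only [Finset.card_univ, Fintype.card_fun, Fintype.card_fin]
          push_cast
          rw [← hM]
          field_simp
        · rw [Finset.sum_comm]
          refine Finset.sum_congr rfl fun S _ => ?_
          rw [Finset.sum_comm]
    _ ≤ X + ∑ S ∈ (Finset.univ : Finset (Fin n)).powerset,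
          Fintype.card (AddSubgroup G) * (2 * (M ^ S.card * f S.card)) := by
        gcongr with S hS
        refine (Finset.sum_le_sum fun K _ => hYsum S K).trans ?_
        rw [Finset.sum_const, nsmul_eq_mul, Finset.card_univ]
    _ = _ := by
        rw [Finset.sum_powerset_apply_card
          (fun s => (Fintype.card (AddSubgroup G) : ℝ) * (2 * (M ^ s * f s)))]
        simp only [Finset.card_univ, Fintype.card_fin, nsmul_eq_mul]
        rw [Finset.mul_sum]
        congr 1
        refine Finset.sum_congr rfl fun s _ => ?_
        simp only [hf]
        split_ifs <;> ring
end
end CokUniv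


namespace CokUniv
open scoped Classical

theorem choose_bound (M : ℝ) (hM : 1 ≤ M) : ∃ δ : ℝ, 0 < δ ∧ ∀ n s : ℕ, (s : ℝ) ≤ M * (δ * n) →
    (n.choose s : ℝ) * M ^ s ≤ Real.exp (n / (4 * M)) := by
  have hM0 : 0 < M := by linarith
  set y : ℝ := 1 / (8 * M ^ 2) with hy
  have hy0 : 0 < y := by positivity
  have hlog : 0 < Real.log (8 * M ^ 2) := by
    apply Real.log_pos; nlinarith
  refine ⟨1 / (8 * M ^ 2 * Real.log (8 * M ^ 2)), by positivity, fun n s hs => ?_⟩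
  by_cases hsn : s ≤ n
  · have h1 : (n.choose s : ℝ) * (M * y) ^ s ≤ (1 + M * y) ^ n := by
      rw [add_comm, add_pow]
      refine le_trans ?_ (Finset.single_le_sum (f := fun m => (M * y) ^ m * 1 ^ (n - m) * (n.choose m : ℝ))
        (fun m _ => by positivity) (by simp; omega : s ∈ Finset.range (n + 1)))
      simp only [one_pow, mul_one]
      rw [mul_comm]
    have h2 : (1 + M * y) ^ n ≤ Real.exp (n * (M * y)) := by
      rw [Real.exp_nat_mul]
      apply pow_le_pow_left₀ (by positivity)
      rw [add_comm]; exact Real.add_one_le_exp _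
    have h3 : (y⁻¹) ^ s ≤ Real.exp (n / (8 * M)) := by
      have : y⁻¹ = Real.exp (Real.log (8 * M ^ 2)) := by
        rw [Real.exp_log (by positivity), hy]; simp
      rw [this, ← Real.exp_nat_mul]
      apply Real.exp_le_exp.2
      calc _ ≤ M * (1 / (8 * M ^ 2 * Real.log (8 * M ^ 2)) * n) * Real.log (8 * M ^ 2) :=
            mul_le_mul_of_nonneg_right hs hlog.le
        _ = _ := by
            generalize Real.log (8 * M ^ 2) = l at hlog
            field_simp
    calc (n.choose s : ℝ) * M ^ s = ((n.choose s : ℝ) * (M * y) ^ s) * (y⁻¹) ^ s := by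
          rw [mul_pow, mul_assoc, mul_assoc, ← mul_pow, mul_inv_cancel₀ hy0.ne', one_pow, mul_one]
      _ ≤ Real.exp (n * (M * y)) * Real.exp (n / (8 * M)) := by
          apply mul_le_mul (h1.trans h2) h3 (by positivity) (by positivity)
      _ = _ := by
          rw [← Real.exp_add, hy]; congr 1; field_simp; ring
  · rw [Nat.choose_eq_zero_of_lt (by omega)]
    simp; positivity

theorem one_sub_exp_lower (x : ℝ) (hx : 0 ≤ x) : min x 1 / 2 ≤ 1 - Real.exp (-x) := by
  have key : ∀ y : ℝ, 0 ≤ y → y ≤ 1 → y / 2 ≤ 1 - Real.exp (-y) := by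
    intro y h0 h1
    have h2 : Real.exp (-y) ≤ 1 / (1 + y) := by
      rw [Real.exp_neg, inv_eq_one_div]
      apply one_div_le_one_div_of_le (by linarith)
      have := Real.add_one_le_exp y; linarith
    have h3 : 1 / (1 + y) ≤ 1 - y / 2 := by
      rw [div_le_iff₀ (by linarith)]; nlinarith
    linarith
  rcases le_total x 1 with h | h
  · rw [min_eq_left h]; exact key x hx h
  · rw [min_eq_right h]
    have h1 := key 1 zero_le_one le_rfl
    have : Real.exp (-x) ≤ Real.exp (-1) := Real.exp_le_exp.2 (by linarith)
    linarith

theorem term_bound (M κ δ a Δ : ℝ) (n : ℕ) (hM : 1 ≤ M) (hκ : 0 < κ) (hδ : 0 < δ)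
    (hch : ∀ n s : ℕ, (s : ℝ) ≤ M * (δ * n) → (n.choose s : ℝ) * M ^ s ≤ Real.exp (n / (4 * M)))
    (hn : 1 ≤ n) (hnM : M ≤ n)
    (hΔ1 : 6 * M ^ 2 / κ ≤ Δ) (hΔ2 : 2 / (κ * δ) ≤ Δ) (ha : Δ * Real.log n / n ≤ a)
    (s : ℕ) (hs1 : 1 ≤ s) (hs : (s : ℝ) ≤ M * (δ * n)) :
    (n.choose s : ℝ) * M ^ s * Bq M (κ * a) (δ * n) s ^ n ≤
      Real.exp M * (M / n ^ 2 + Real.exp (-(n / (4 * M)))) := by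
  have hM0 : 0 < M := by linarith
  have hn0 : (0 : ℝ) < n := by exact_mod_cast hn
  have hn1 : (1 : ℝ) ≤ n := by exact_mod_cast hn
  have hs1' : (1 : ℝ) ≤ s := by exact_mod_cast hs1
  have hlog0 : 0 ≤ Real.log n := Real.log_nonneg hn1
  have hΔ0 : 0 < Δ := lt_of_lt_of_le (by positivity) hΔ1
  have ha0 : 0 ≤ a := le_trans (by positivity) ha
  have han : Δ * Real.log n ≤ a * n := by rwa [div_le_iff₀ hn0] at ha
  -- epsilon bound
  have hε : Real.exp (-(κ * a * (δ * n))) ≤ 1 / n ^ 2 := by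
    have h1 : 2 * Real.log n ≤ κ * a * (δ * n) := by
      have h2 : 2 ≤ κ * δ * Δ := by
        rw [div_le_iff₀ (by positivity)] at hΔ2; linarith
      calc 2 * Real.log n ≤ κ * δ * Δ * Real.log n := mul_le_mul_of_nonneg_right h2 hlog0
        _ = κ * δ * (Δ * Real.log n) := by ring
        _ ≤ κ * δ * (a * n) := mul_le_mul_of_nonneg_left han (by positivity)
        _ = _ := by ring
    calc _ ≤ Real.exp (-(2 * Real.log n)) := Real.exp_le_exp.2 (by linarith)
      _ = 1 / n ^ 2 := by
        rw [Real.exp_neg, two_mul, Real.exp_add, Real.exp_log hn0]; field_simp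
  set x := κ * a * s / M with hx
  have hx0 : 0 ≤ x := by positivity
  have hB : Bq M (κ * a) (δ * n) s ≤ Real.exp (-(1 / M * (min x 1 / 2)) + M / n ^ 2) := by
    refine le_trans ?_ (Real.add_one_le_exp _)
    unfold Bq
    have h1 := one_sub_exp_lower x hx0
    have h2 : 1 / M * (min x 1 / 2) ≤ 1 / M * (1 - Real.exp (-x)) :=
      mul_le_mul_of_nonneg_left h1 (by positivity)
    have h3 : M * Real.exp (-(κ * a * (δ * n))) ≤ M / n ^ 2 := by
      calc _ ≤ M * (1 / n ^ 2) := mul_le_mul_of_nonneg_left hε hM0.le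
        _ = _ := by ring
    linarith
  have hB0 : 0 ≤ Bq M (κ * a) (δ * n) s := by
    unfold Bq
    have h1 : 1 / M ≤ 1 := by rw [div_le_one hM0]; exact hM
    have h2 : 0 < 1 / M := by positivity
    have h3 : 0 < M * Real.exp (-(κ * a * (δ * n))) := by positivity
    have h4 := Real.exp_pos (-(κ * a * s / M))
    nlinarith
  have hBn : Bq M (κ * a) (δ * n) s ^ n ≤ Real.exp M * Real.exp (-(n / M * (min x 1 / 2))) := by
    refine (pow_le_pow_left₀ hB0 hB n).trans ?_
    rw [← Real.exp_nat_mul, ← Real.exp_add]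
    apply Real.exp_le_exp.2
    have : (n : ℝ) * (M / n ^ 2) ≤ M := by
      rw [mul_div_assoc', div_le_iff₀ (by positivity)]; nlinarith [mul_nonneg hM0.le (by nlinarith : (0:ℝ) ≤ (n:ℝ)^2 - n)]
    calc _ = -(n / M * (min x 1 / 2)) + n * (M / n ^ 2) := by ring
      _ ≤ _ := by linarith
  have hC0 : 0 ≤ (n.choose s : ℝ) * M ^ s := by positivity
  have hfin : (n.choose s : ℝ) * M ^ s * Real.exp (-(n / M * (min x 1 / 2))) ≤
      M / n ^ 2 + Real.exp (-(n / (4 * M))) := by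
    rcases le_total x 1 with h | h
    · rw [min_eq_left h]
      have h1 : Real.exp (-(n / M * (x / 2))) ≤ (1 / n ^ 3) ^ s := by
        have h2 : 3 * Real.log n * s ≤ n / M * (x / 2) := by
          have h3 : 6 * M ^ 2 ≤ Δ * κ := by rwa [div_le_iff₀ hκ] at hΔ1
          have h4 : n / M * (x / 2) = κ * (a * n) * s / (2 * M ^ 2) := by
            rw [hx]; field_simp
          rw [h4, le_div_iff₀ (by positivity)]
          calc 3 * Real.log n * s * (2 * M ^ 2) = (6 * M ^ 2) * (Real.log n * s) := by ring
            _ ≤ (Δ * κ) * (Real.log n * s) := mul_le_mul_of_nonneg_right h3 (by positivity)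
            _ = κ * (Δ * Real.log n) * s := by ring
            _ ≤ _ := by gcongr
        calc _ ≤ Real.exp (-(3 * Real.log n * s)) := Real.exp_le_exp.2 (by linarith)
          _ = (Real.exp (-(3 * Real.log n))) ^ s := by rw [← Real.exp_nat_mul]; congr 1; ring
          _ = _ := by
            congr 1
            have : (3 : ℝ) * Real.log n = (3 : ℕ) * Real.log n := by norm_num
            rw [Real.exp_neg, this, Real.exp_nat_mul, Real.exp_log hn0, inv_eq_one_div]
      have h5 : (n.choose s : ℝ) ≤ n ^ s := by exact_mod_cast Nat.choose_le_pow n s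
      calc _ ≤ (n : ℝ) ^ s * M ^ s * (1 / n ^ 3) ^ s := by gcongr
        _ = (M / n ^ 2) ^ s := by
          rw [← mul_pow, ← mul_pow]; congr 1; field_simp
        _ ≤ M / n ^ 2 := by
          apply pow_le_of_le_one (by positivity) _ (by omega)
          rw [div_le_one (by positivity)]; nlinarith
        _ ≤ _ := by linarith [Real.exp_pos (-(n / (4 * M)))]
    · rw [min_eq_right h]
      calc _ ≤ Real.exp (n / (4 * M)) * Real.exp (-(n / M * (1 / 2))) := by
            gcongr; exact hch n s hs
        _ = Real.exp (-(n / (4 * M))) := by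
            rw [← Real.exp_add]; congr 1; field_simp; norm_num
        _ ≤ _ := by
            have : 0 ≤ M / n ^ 2 := by positivity
            linarith
  calc _ ≤ (n.choose s : ℝ) * M ^ s * (Real.exp M * Real.exp (-(n / M * (min x 1 / 2)))) :=
        mul_le_mul_of_nonneg_left hBn hC0
    _ = Real.exp M * ((n.choose s : ℝ) * M ^ s * Real.exp (-(n / M * (min x 1 / 2)))) := by ring
    _ ≤ _ := mul_le_mul_of_nonneg_left hfin (Real.exp_pos _).le

theorem eps_bound (κ δ a Δ : ℝ) (n : ℕ) (hκ : 0 < κ) (hδ : 0 < δ) (hn : 1 ≤ n)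
    (hΔ2 : 2 / (κ * δ) ≤ Δ) (ha : Δ * Real.log n / n ≤ a) :
    Real.exp (-(κ * a * (δ * n))) ≤ 1 / n ^ 2 := by
  have hn0 : (0 : ℝ) < n := by exact_mod_cast hn
  have hn1 : (1 : ℝ) ≤ n := by exact_mod_cast hn
  have hlog0 : 0 ≤ Real.log n := Real.log_nonneg hn1
  have han : Δ * Real.log n ≤ a * n := by rwa [div_le_iff₀ hn0] at ha
  have h1 : 2 * Real.log n ≤ κ * a * (δ * n) := by
    have h2 : 2 ≤ κ * δ * Δ := by
      rw [div_le_iff₀ (by positivity)] at hΔ2; linarith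
    calc 2 * Real.log n ≤ κ * δ * Δ * Real.log n := mul_le_mul_of_nonneg_right h2 hlog0
      _ = κ * δ * (Δ * Real.log n) := by ring
      _ ≤ κ * δ * (a * n) := mul_le_mul_of_nonneg_left han (by positivity)
      _ = _ := by ring
  calc _ ≤ Real.exp (-(2 * Real.log n)) := Real.exp_le_exp.2 (by linarith)
    _ = 1 / n ^ 2 := by
      rw [Real.exp_neg, two_mul, Real.exp_add, Real.exp_log hn0]; field_simp

theorem Err_tendsto (p L : ℕ) [Fact p.Prime] (G : Type) [AddCommGroup G]
    [Module (ZMod (p ^ L)) G] [Fintype G] (α : ℕ → ℝ) (hα : ∀ n, 0 < α n)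
    (hαlog : ∀ Δ : ℝ, 0 < Δ → ∀ᶠ n : ℕ in atTop, Δ * Real.log n / n ≤ α n)
    (w : ∀ n : ℕ, Fin n → Fin n → ZMod (p ^ L) → ℝ) (hw : ∀ n, Adm p L (w n) (α n)) :
    Tendsto (fun n => Err G (w n)) atTop (nhds 0) := by
  obtain ⟨κ, hκ, hcb⟩ := prod_char_bound p L
  set M : ℝ := (Fintype.card G : ℝ) with hMdef
  have hM : 1 ≤ M := by
    rw [hMdef]; exact_mod_cast Fintype.card_pos
  have hM0 : 0 < M := by linarith
  obtain ⟨δ, hδ, hch⟩ := choose_bound M hM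
  set Δ := max (6 * M ^ 2 / κ) (2 / (κ * δ)) with hΔ
  have hΔ0 : 0 < Δ := lt_max_of_lt_left (by positivity)
  set Cn : ℝ := 2 * Fintype.card (AddSubgroup G) with hCn
  have hupper : ∀ᶠ n : ℕ in atTop, Err G (w n) ≤ (Real.exp (M * (1 / n)) - 1) +
      Cn * ((n + 1) * (Real.exp M * (M / n ^ 2 + Real.exp (-(n / (4 * M)))))) := by
    filter_upwards [hαlog Δ hΔ0, eventually_ge_atTop 1, eventually_ge_atTop ⌈M⌉₊] with n hn hn1 hnM
    have hn0 : (0 : ℝ) < n := by exact_mod_cast hn1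
    have hnM' : M ≤ n := (Nat.le_ceil M).trans (by exact_mod_cast hnM)
    refine (Err_le (hw n) (c := κ * α n) (t := δ * n) (mul_nonneg hκ.le (hα n).le) (by positivity)
      (fun g χ l => ?_)).trans ?_
    · exact hcb G n (w n) (α n) (hw n) g χ l
    · apply add_le_add
      · apply sub_le_sub_right
        apply Real.exp_le_exp.2
        have := eps_bound κ δ (α n) Δ n hκ hδ hn1 (le_max_right _ _) hn
        calc _ ≤ (n : ℝ) * (M * (1 / n ^ 2)) := by gcongr
          _ = _ := by field_simp
      · apply mul_le_mul_of_nonneg_left _ (by positivity)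
        calc _ ≤ ∑ s ∈ Finset.range (n + 1), (Real.exp M * (M / n ^ 2 + Real.exp (-(n / (4 * M))))) := by
              refine Finset.sum_le_sum fun s _ => ?_
              split_ifs with h
              · exact term_bound M κ δ (α n) Δ n hM hκ hδ hch hn1 hnM' (le_max_left _ _)
                  (le_max_right _ _) hn s h.1 h.2
              · positivity
          _ = _ := by rw [Finset.sum_const, Finset.card_range, nsmul_eq_mul]; push_cast; ring
  have hlim : Tendsto (fun n : ℕ => (Real.exp (M * (1 / (n : ℝ))) - 1) +
      Cn * (((n : ℝ) + 1) * (Real.exp M * (M / (n : ℝ) ^ 2 + Real.exp (-((n : ℝ) / (4 * M))))))) atTop (nhds 0) := by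
    have h1 : Tendsto (fun n : ℕ => 1 / (n : ℝ)) atTop (nhds 0) := tendsto_one_div_atTop_nhds_zero_nat
    have h2 : Tendsto (fun n : ℕ => Real.exp (M * (1 / (n : ℝ))) - 1) atTop (nhds 0) := by
      have := (Real.continuous_exp.tendsto _).comp (h1.const_mul M)
      have := this.sub_const 1
      simpa using this
    have hs : Tendsto (fun x : ℝ => (4 * M)⁻¹ * x) atTop atTop :=
      tendsto_id.const_mul_atTop (by positivity)
    have h3 : Tendsto (fun x : ℝ => x * Real.exp (-((4 * M)⁻¹ * x))) atTop (nhds 0) := by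
      have := ((Real.tendsto_pow_mul_exp_neg_atTop_nhds_zero 1).comp hs).const_mul (4 * M)
      rw [mul_zero] at this
      refine this.congr fun x => ?_
      simp only [Function.comp, pow_one]
      field_simp
    have h3' := h3.comp (tendsto_natCast_atTop_atTop (R := ℝ))
    have h4 : Tendsto (fun x : ℝ => Real.exp (-((4 * M)⁻¹ * x))) atTop (nhds 0) := 
      Real.tendsto_exp_neg_atTop_nhds_zero.comp hs
    have h4' := h4.comp (tendsto_natCast_atTop_atTop (R := ℝ))
    have h5 : Tendsto (fun n : ℕ => Cn * Real.exp M * (M * (1 / (n : ℝ) + (1 / (n : ℝ)) * (1 / (n : ℝ))) +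
        ((n : ℝ) * Real.exp (-((4 * M)⁻¹ * n)) + Real.exp (-((4 * M)⁻¹ * n))))) atTop (nhds 0) := by
      have := (((h1.add (h1.mul h1)).const_mul M).add (h3'.add h4')).const_mul (Cn * Real.exp M)
      simpa using this
    have h6 := h2.add h5
    rw [add_zero] at h6
    refine h6.congr' ?_
    filter_upwards [eventually_ge_atTop 1] with n hn
    have hn0 : (0 : ℝ) < n := by exact_mod_cast hn
    have e : (4 * M)⁻¹ * (n : ℝ) = n / (4 * M) := by ring
    rw [e]
    congr 1
    field_simp
  refine tendsto_of_tendsto_of_tendsto_of_le_of_le' tendsto_const_nhds hlim ?_ hupper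
  exact Eventually.of_forall fun n => Finset.sum_nonneg fun _ _ => abs_nonneg _

end CokUniv


namespace CokUniv
open scoped Classical

/-- falling q-power -/
noncomputable def fall (q : ℝ) (r k : ℕ) : ℝ := ∏ i ∈ Finset.range k, (q ^ r - q ^ i)

/-- inclusion-exclusion coefficients -/
noncomputable def aq (q : ℝ) (k : ℕ) : ℝ := ∏ j ∈ Finset.range k, (-1 / (q ^ (j + 1) - 1))

theorem fall_succ (q : ℝ) (r k : ℕ) : fall q r (k + 1) = fall q r k * (q ^ r - q ^ k) := by
  unfold fall; rw [Finset.prod_range_succ]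

theorem fall_succ_succ (q : ℝ) (r k : ℕ) :
    fall q (r + 1) (k + 1) = (q ^ (r + 1) - 1) * q ^ k * fall q r k := by
  unfold fall
  rw [Finset.prod_range_succ']
  have : ∀ i, q ^ (r + 1) - q ^ (i + 1) = q * (q ^ r - q ^ i) := by intro i; ring
  simp_rw [this]
  rw [Finset.prod_mul_distrib, Finset.prod_const, Finset.card_range]
  ring

theorem aq_succ (q : ℝ) (k : ℕ) : aq q (k + 1) = aq q k * (-1 / (q ^ (k + 1) - 1)) := by
  unfold aq; rw [Finset.prod_range_succ]

theorem fall_zero_left (q : ℝ) (k : ℕ) : fall q 0 (k + 1) = 0 := by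
  unfold fall
  rw [Finset.prod_range_succ']; simp

theorem fall_eq_zero (q : ℝ) {r k : ℕ} (h : r < k) : fall q r k = 0 := by
  unfold fall
  exact Finset.prod_eq_zero (Finset.mem_range.2 h) (by simp)

theorem fall_nonneg {q : ℝ} (hq : 1 ≤ q) (r k : ℕ) : 0 ≤ fall q r k := by
  rcases lt_or_ge r k with h | h
  · rw [fall_eq_zero q h]
  · unfold fall
    refine Finset.prod_nonneg fun i hi => ?_
    rw [Finset.mem_range] at hi
    rw [sub_nonneg]
    exact pow_le_pow_right₀ hq (by omega)

theorem fall_le {q : ℝ} (hq : 1 ≤ q) (r k : ℕ) : fall q r k ≤ (q ^ r) ^ k := by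
  rcases lt_or_ge r k with h | h
  · rw [fall_eq_zero q h]; positivity
  · unfold fall
    calc _ ≤ ∏ i ∈ Finset.range k, q ^ r := by
          refine Finset.prod_le_prod (fun i hi => ?_) fun i hi => ?_
          · rw [Finset.mem_range] at hi
            rw [sub_nonneg]
            exact pow_le_pow_right₀ hq (by omega)
          · have : 0 ≤ q ^ i := by positivity
            linarith
      _ = _ := by rw [Finset.prod_const, Finset.card_range]

theorem qpow_sub_pos {q : ℝ} (hq : 1 < q) (k : ℕ) : 0 < q ^ (k + 1) - 1 := by
  have : 1 < q ^ (k + 1) := one_lt_pow₀ hq (Nat.succ_ne_zero k)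
  linarith

theorem partial_sum {q : ℝ} (hq : 1 < q) (r J : ℕ) :
    ∑ k ∈ Finset.range (J + 1), aq q k * fall q (r + 1) k = aq q J * q ^ J * fall q r J := by
  induction J with
  | zero => simp [aq, fall]
  | succ J ih =>
    rw [Finset.sum_range_succ, ih, aq_succ, fall_succ_succ, fall_succ]
    have := (qpow_sub_pos hq J).ne'
    field_simp
    ring

theorem aq_sign {q : ℝ} (hq : 1 < q) (J : ℕ) : 0 ≤ (-1) ^ J * aq q J := by
  induction J with
  | zero => simp [aq]
  | succ J ih =>
    rw [aq_succ]
    have h := qpow_sub_pos hq J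
    have : (-1 : ℝ) ^ (J + 1) * (aq q J * (-1 / (q ^ (J + 1) - 1))) =
      ((-1) ^ J * aq q J) * (1 / (q ^ (J + 1) - 1)) := by ring
    rw [this]
    positivity

theorem partial_zero (q : ℝ) (J : ℕ) :
    ∑ k ∈ Finset.range (J + 1), aq q k * fall q 0 k = 1 := by
  rw [Finset.sum_range_succ']
  simp [fall_zero_left]
  simp [aq, fall]

theorem bonf_upper {q : ℝ} (hq : 1 < q) (r J : ℕ) :
    (if r = 0 then (1 : ℝ) else 0) ≤ ∑ k ∈ Finset.range (2 * J + 1), aq q k * fall q r k := by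
  cases r with
  | zero => rw [partial_zero]; simp
  | succ r =>
    rw [partial_sum hq]
    have := aq_sign hq (2 * J)
    rw [pow_mul] at this
    simp only [even_two, Even.neg_pow, one_pow, one_mul] at this
    have h2 := fall_nonneg hq.le r (2 * J)
    simp
    positivity

theorem bonf_lower {q : ℝ} (hq : 1 < q) (r J : ℕ) :
    ∑ k ∈ Finset.range (2 * J + 1 + 1), aq q k * fall q r k ≤ (if r = 0 then (1 : ℝ) else 0) := by
  cases r with
  | zero => rw [partial_zero]; simp
  | succ r =>
    rw [partial_sum hq]
    have := aq_sign hq (2 * J + 1)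
    rw [pow_succ, pow_mul] at this
    simp only [even_two, Even.neg_pow, one_pow, one_mul] at this
    have h2 := fall_nonneg hq.le r (2 * J + 1)
    have h3 : 0 ≤ q ^ (2 * J + 1) := by positivity
    simp only [Nat.add_eq_zero_iff, one_ne_zero, and_false, if_false]
    have : aq q (2 * J + 1) ≤ 0 := by linarith
    rw [mul_assoc]
    exact mul_nonpos_of_nonpos_of_nonneg this (mul_nonneg h3 h2)

theorem qbinom {q : ℝ} (hq : 1 < q) (r : ℕ) : ∀ (y : ℝ) (m : ℕ), r ≤ m →
    ∑ k ∈ Finset.range (m + 1), aq q k * fall q r k * y ^ k = ∏ i ∈ Finset.range r, (1 - y * q ^ i) := by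
  induction r with
  | zero =>
    intro y m _
    rw [Finset.sum_range_succ']
    simp [fall_zero_left]
    simp [aq, fall]
  | succ r ih =>
    intro y m hm
    rw [Finset.prod_range_succ']
    have e : ∀ i, (1 - y * q ^ (i + 1)) = 1 - (y * q) * q ^ i := by intro i; ring
    simp_rw [e]
    rw [← ih (y * q) m (by omega), pow_zero, mul_one]
    have h0 : ∀ k, aq q (k + 1) * fall q (r + 1) (k + 1) * y ^ (k + 1) =
      aq q (k + 1) * fall q r (k + 1) * (y * q) ^ (k + 1) - y * (aq q k * fall q r k * (y * q) ^ k) := by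
      intro k
      rw [aq_succ, fall_succ_succ, fall_succ]
      have := (qpow_sub_pos hq k).ne'
      rw [mul_pow, mul_pow]
      field_simp
      ring
    rw [Finset.sum_range_succ']
    simp_rw [h0]
    rw [Finset.sum_sub_distrib, ← Finset.mul_sum]
    obtain ⟨m, rfl⟩ : ∃ m', m = m' + 1 := ⟨m - 1, by omega⟩
    rw [Finset.sum_range_succ' _ (m + 1)]
    have h1 : ∑ k ∈ Finset.range (m + 1), aq q k * fall q r k * (y * q) ^ k =
      ∑ k ∈ Finset.range (m + 1 + 1), aq q k * fall q r k * (y * q) ^ k := by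
      rw [Finset.sum_range_succ _ (m + 1), fall_eq_zero q (by omega : r < m + 1)]; simp
    rw [h1, Finset.sum_range_succ' _ (m + 1)]
    simp [fall]
    ring

theorem fall_ratio_tendsto {q : ℝ} (hq : 1 < q) (k : ℕ) :
    Tendsto (fun r : ℕ => fall q r k * ((q ^ r) ^ k)⁻¹) atTop (nhds 1) := by
  have h : ∀ r, fall q r k * ((q ^ r) ^ k)⁻¹ = ∏ i ∈ Finset.range k, (1 - q ^ i * (q⁻¹) ^ r) := by
    intro r
    unfold fall
    have : ((q ^ r) ^ k)⁻¹ = ∏ i ∈ Finset.range k, (q ^ r)⁻¹ := by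
      rw [Finset.prod_const, Finset.card_range, inv_pow]
    rw [this, ← Finset.prod_mul_distrib]
    refine Finset.prod_congr rfl fun i _ => ?_
    have : q ^ r ≠ 0 := by positivity
    rw [inv_pow]
    field_simp
  simp_rw [h]
  have h1 : Tendsto (fun r : ℕ => (q⁻¹) ^ r) atTop (nhds 0) :=
    tendsto_pow_atTop_nhds_zero_of_lt_one (by positivity) (inv_lt_one_of_one_lt₀ hq)
  have h2 : Tendsto (fun r : ℕ => ∏ i ∈ Finset.range k, (1 - q ^ i * (q⁻¹) ^ r)) atTop
      (nhds (∏ i ∈ Finset.range k, (1 - q ^ i * 0))) := by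
    apply tendsto_finsetProd
    intro i _
    exact tendsto_const_nhds.sub (h1.const_mul _)
  simpa using h2

theorem aq_abs_le {q : ℝ} (hq : 2 ≤ q) (k : ℕ) : |aq q k| ≤ 1 / (k.factorial : ℝ) := by
  induction k with
  | zero => simp [aq]
  | succ k ih =>
    rw [aq_succ, abs_mul]
    have hp := qpow_sub_pos (by linarith : 1 < q) k
    have h1 : ((k + 1 : ℕ) : ℝ) ≤ q ^ (k + 1) - 1 := by
      have h2 : (2 : ℝ) ^ (k + 1) ≤ q ^ (k + 1) := pow_le_pow_left₀ (by norm_num) hq _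
      have h3 : ((k + 1 : ℕ) : ℝ) + 1 ≤ 2 ^ (k + 1) := by
        exact_mod_cast (Nat.lt_two_pow_self (n := k + 1))
      linarith
    rw [abs_div, abs_neg, abs_one, abs_of_pos hp, Nat.factorial_succ]
    push_cast at h1 ⊢
    calc _ ≤ 1 / (k.factorial : ℝ) * (1 / (k + 1)) := by gcongr
      _ = _ := by rw [div_mul_div_comm, mul_one, mul_comm]

theorem aq_summable {q : ℝ} (hq : 2 ≤ q) : Summable (aq q) := by
  apply Summable.of_norm_bounded (g := fun k : ℕ => (1 : ℝ) ^ k / k.factorial)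
    (Real.summable_pow_div_factorial 1)
  intro k
  rw [one_pow]
  exact aq_abs_le hq k

theorem aq_tendsto {q : ℝ} (hq : 2 ≤ q) :
    Tendsto (fun J => ∑ k ∈ Finset.range J, aq q k) atTop
      (nhds (∏' i : ℕ, (1 - (q⁻¹) ^ (i + 1)))) := by
  have hq1 : 1 < q := by linarith
  have hq0 : 0 < q := by linarith
  have key : ∑' k, aq q k = ∏' i : ℕ, (1 - (q⁻¹) ^ (i + 1)) := by
    have h1 : Tendsto (fun r : ℕ => ∑' k, aq q k * (fall q r k * ((q ^ r) ^ k)⁻¹)) atTop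
        (nhds (∑' k, aq q k * 1)) := by
      apply tendsto_tsum_of_dominated_convergence (bound := fun k => ‖aq q k‖)
      · exact (aq_summable hq).norm
      · intro k
        exact (fall_ratio_tendsto hq1 k).const_mul _
      · refine Eventually.of_forall fun r k => ?_
        rw [norm_mul]
        apply mul_le_of_le_one_right (norm_nonneg _)
        have h2 := fall_nonneg hq1.le r k
        rw [Real.norm_of_nonneg (by positivity), ← div_eq_mul_inv, div_le_one (by positivity)]
        exact fall_le hq1.le r k
    simp only [mul_one] at h1
    have h2 : ∀ r : ℕ, ∑' k, aq q k * (fall q r k * ((q ^ r) ^ k)⁻¹) =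
        ∏ i ∈ Finset.range r, (1 - (q⁻¹) ^ (i + 1)) := by
      intro r
      rw [tsum_eq_sum (s := Finset.range (r + 1))]
      · have := qbinom hq1 r ((q ^ r)⁻¹) r le_rfl
        rw [← Finset.prod_range_reflect]
        convert this using 1
        · refine Finset.sum_congr rfl fun k _ => ?_
          rw [inv_pow]; ring
        · refine Finset.prod_congr rfl fun i hi => ?_
          rw [Finset.mem_range] at hi
          congr 1
          rw [inv_pow, ← one_div, ← one_div, div_mul_eq_mul_div, one_mul, div_eq_div_iff (by positivity) (by positivity),
            one_mul, ← pow_add]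
          congr 1; omega
      · intro k hk
        rw [fall_eq_zero q (by simpa using hk)]; simp
    simp_rw [h2] at h1
    have h3 : Multipliable (fun i : ℕ => (1 - (q⁻¹) ^ (i + 1))) := by
      have : Summable (fun i : ℕ => -((q⁻¹) ^ (i + 1))) := by
        apply Summable.neg
        exact (summable_nat_add_iff 1).2
          (summable_geometric_of_lt_one (by positivity) (inv_lt_one_of_one_lt₀ hq1))
      have := Real.multipliable_one_add_of_summable this
      simpa [sub_eq_add_neg] using this
    exact tendsto_nhds_unique h1 h3.hasProd.tendsto_prod_nat
  rw [← key]
  exact (aq_summable hq).hasSum.tendsto_sum_nat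

theorem card_li (p : ℕ) [Fact p.Prime] (V : Type*) [AddCommGroup V] [Module (ZMod p) V] [Finite V] (k : ℕ) :
    (Nat.card {s : Fin k → V // LinearIndependent (ZMod p) s} : ℝ) =
      fall p (Module.finrank (ZMod p) V) k := by
  have : Fintype V := Fintype.ofFinite V
  rcases le_or_gt k (Module.finrank (ZMod p) V) with h | h
  · rw [card_linearIndependent h]
    unfold fall
    rw [← Fin.prod_univ_eq_prod_range (fun i => ((p : ℝ) ^ (Module.finrank (ZMod p) V) - (p : ℝ) ^ i))]
    push_cast
    refine Finset.prod_congr rfl fun i _ => ?_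
    rw [ZMod.card, Nat.cast_sub]
    · push_cast; rfl
    · exact Nat.pow_le_pow_right (Fact.out : p.Prime).pos (by have := i.2; omega)
  · rw [fall_eq_zero _ h]
    have : IsEmpty {s : Fin k → V // LinearIndependent (ZMod p) s} := by
      refine ⟨fun s => ?_⟩
      have := s.2.fintype_card_le_finrank
      simp at this
      omega
    simp
end CokUniv


namespace CokUniv
open scoped Classical

instance finite_hom (p : ℕ) [Fact p.Prime] (W : Type*) [AddCommGroup W] [Finite W] :
    Finite (W →+ ZMod p) :=
  Finite.of_injective (fun f : W →+ ZMod p => (f : W → ZMod p)) DFunLike.coe_injective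

noncomputable instance fintype_hom (p : ℕ) [Fact p.Prime] (W : Type*) [AddCommGroup W] [Finite W] :
    Fintype (W →+ ZMod p) := Fintype.ofFinite _

theorem exists_hom_ne_aux (p : ℕ) [Fact p.Prime] (V : Type*) [AddCommGroup V] [Module (ZMod p) V]
    (x : V) (hx : x ≠ 0) : ∃ f : V →+ ZMod p, f x ≠ 0 := by
  by_contra hcon
  push Not at hcon
  exact hx ((Module.forall_dual_apply_eq_zero_iff (ZMod p) x).1 (fun φ => hcon φ.toAddMonoidHom))

theorem card_hom_tors_aux (p : ℕ) [Fact p.Prime] (V : Type*) [AddCommGroup V] [Module (ZMod p) V]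
    [Finite V] : Nat.card (V →+ ZMod p) = Nat.card V := by
  have e2 : (V →+ ZMod p) ≃ Module.Dual (ZMod p) V :=
    (AddMonoidHom.toZModLinearMapEquiv p).toEquiv
  rw [Nat.card_congr e2, Module.natCard_eq_pow_finrank (K := ZMod p) (V := Module.Dual (ZMod p) V),
    Module.natCard_eq_pow_finrank (K := ZMod p) (V := V), Subspace.dual_finrank_eq]

theorem exists_hom_ne (p : ℕ) [Fact p.Prime] (V : Type*) [AddCommGroup V] (h : ∀ x : V, p • x = 0)
    (x : V) (hx : x ≠ 0) : ∃ f : V →+ ZMod p, f x ≠ 0 :=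
  @exists_hom_ne_aux p _ V _ (AddCommGroup.zmodModule h) x hx

theorem card_hom_tors (p : ℕ) [Fact p.Prime] (V : Type*) [AddCommGroup V] (h : ∀ x : V, p • x = 0)
    [Finite V] : Nat.card (V →+ ZMod p) = Nat.card V :=
  @card_hom_tors_aux p _ V _ (AddCommGroup.zmodModule h) _

/-- A proper subgroup of a `p`-power torsion group is killed by a nonzero mod `p` functional. -/
theorem exists_hom (p L : ℕ) [Fact p.Prime] (N : Type*) [AddCommGroup N]
    (hN : ∀ x : N, (p ^ L) • x = 0) (K : AddSubgroup N) (hK : K ≠ ⊤) :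
    ∃ f : N →+ ZMod p, f ≠ 0 ∧ ∀ x ∈ K, f x = 0 := by
  set P : AddSubgroup N := (nsmulAddMonoidHom (α := N) p).range with hP
  have hne : K ⊔ P ≠ ⊤ := by
    intro htop
    apply hK
    have key : ∀ j : ℕ, ∀ x : N, ∃ k ∈ K, ∃ y : N, x = k + (p ^ j) • y := by
      intro j
      induction j with
      | zero => exact fun x => ⟨0, K.zero_mem, x, by simp⟩
      | succ j ih =>
        intro x
        obtain ⟨k, hk, y, hy⟩ := ih x
        have : y ∈ K ⊔ P := by rw [htop]; trivial
        obtain ⟨k', hk', z, hz, hkz⟩ := AddSubgroup.mem_sup.1 this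
        obtain ⟨z', hz'⟩ := hz
        refine ⟨k + (p ^ j) • k', K.add_mem hk (K.nsmul_mem hk' _), z', ?_⟩
        rw [hy, ← hkz, ← hz']
        simp only [nsmulAddMonoidHom_apply, smul_add, pow_succ, mul_smul, add_assoc]
    refine eq_top_iff.2 fun x _ => ?_
    obtain ⟨k, hk, y, hy⟩ := key L x
    rw [hy, hN y, add_zero]; exact hk
  have htor : ∀ y : N ⧸ (K ⊔ P), p • y = 0 := by
    intro y
    induction y using QuotientAddGroup.induction_on with
    | H y =>
      rw [← QuotientAddGroup.mk_nsmul, QuotientAddGroup.eq_zero_iff]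
      exact (le_sup_right : P ≤ K ⊔ P) ⟨y, rfl⟩
  obtain ⟨x, hx⟩ : ∃ x : N, x ∉ K ⊔ P := by
    by_contra h; push Not at h; exact hne (eq_top_iff.2 fun x _ => h x)
  have hx' : (QuotientAddGroup.mk x : N ⧸ (K ⊔ P)) ≠ 0 := by
    rwa [Ne, QuotientAddGroup.eq_zero_iff]
  obtain ⟨φ, hφ⟩ := exists_hom_ne p _ htor _ hx'
  refine ⟨φ.comp (QuotientAddGroup.mk' _), ?_, ?_⟩
  · intro h
    apply hφ
    have := DFunLike.congr_fun h x
    simpa using this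
  · intro y hy
    have : (QuotientAddGroup.mk y : N ⧸ (K ⊔ P)) = 0 :=
      (QuotientAddGroup.eq_zero_iff _).2 ((le_sup_left : K ≤ K ⊔ P) hy)
    simp [this]

/-- linearly independent functionals are jointly surjective -/
theorem li_surj (p : ℕ) [Fact p.Prime] (N : Type*) [AddCommGroup N] (k : ℕ)
    (f : Fin k → (N →+ ZMod p)) (hf : LinearIndependent (ZMod p) f) :
    Function.Surjective (fun x i => f i x : N → Fin k → ZMod p) := by
  by_contra hns
  let F : N →+ (Fin k → ZMod p) := AddMonoidHom.mk' (fun x i => f i x) (by intro a b; ext i; simp)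
  let S : Submodule (ZMod p) (Fin k → ZMod p) := AddSubgroup.toZModSubmodule p F.range
  have hS : S < ⊤ := by
    rw [lt_top_iff_ne_top]
    intro h
    apply hns
    intro y
    have : y ∈ S := by rw [h]; trivial
    obtain ⟨x, hx⟩ := this
    exact ⟨x, hx⟩
  obtain ⟨φ, hφ, hle⟩ := S.exists_le_ker_of_lt_top hS
  have hzero : ∑ i, φ (Pi.single i 1) • f i = 0 := by
    ext x
    have h1 : φ (F x) = 0 := hle (show F x ∈ S from ⟨x, rfl⟩)
    rw [LinearMap.pi_apply_eq_sum_univ φ (F x)] at h1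
    simp only [AddMonoidHom.finsetSum_apply, AddMonoidHom.smul_apply, AddMonoidHom.zero_apply]
    rw [← h1]
    refine Finset.sum_congr rfl fun i _ => ?_
    simp only [smul_eq_mul]
    rw [mul_comm]
    congr 2
    ext j; simp [Pi.single_apply, eq_comm]
  have := Fintype.linearIndependent_iff.1 hf _ hzero
  apply hφ
  apply LinearMap.pi_ext'
  intro i
  ext
  simpa using this i

/-- Size of the mod `p` dual. -/
theorem card_hom (p : ℕ) [Fact p.Prime] (N : Type*) [AddCommGroup N] [Finite N] :
    Nat.card (N →+ ZMod p) = Nat.card {x : N // p • x = 0} := by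
  set P : AddSubgroup N := (nsmulAddMonoidHom (α := N) p).range with hP
  have htor : ∀ y : N ⧸ P, p • y = 0 := by
    intro y
    induction y using QuotientAddGroup.induction_on with
    | H y =>
      rw [← QuotientAddGroup.mk_nsmul, QuotientAddGroup.eq_zero_iff]
      exact ⟨y, rfl⟩
  have e1 : (N →+ ZMod p) ≃ ((N ⧸ P) →+ ZMod p) :=
    { toFun := fun f => QuotientAddGroup.lift P f (by rintro _ ⟨x, rfl⟩; simp)
      invFun := fun f => f.comp (QuotientAddGroup.mk' P)
      left_inv := fun f => by ext x; simp
      right_inv := fun f => by ext x; simp }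
  rw [Nat.card_congr e1, card_hom_tors p _ htor]
  have h4 : Nat.card P * Nat.card (N ⧸ P) = Nat.card N := AddSubgroup.card_mul_index P
  have h5 : Nat.card (nsmulAddMonoidHom (α := N) p).ker * Nat.card P = Nat.card N := by
    rw [hP, ← AddSubgroup.index_ker]; exact AddSubgroup.card_mul_index _
  have h6 : Nat.card (nsmulAddMonoidHom (α := N) p).ker = Nat.card {x : N // p • x = 0} := by
    rfl
  rw [← h6]
  have hpos : 0 < Nat.card P := Nat.card_pos
  nlinarith

theorem card_tors (p e : ℕ) [Fact p.Prime] (n : ℕ) :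
    Nat.card {x : Fin n → ZMod (p ^ (e + 1)) // p • x = 0} = p ^ n := by
  have hp : 0 < p := (Fact.out : p.Prime).pos
  have : NeZero (p ^ (e + 1)) := ⟨by positivity⟩
  have h1 : Nat.card {x : ZMod (p ^ (e + 1)) // p • x = 0} = p := by
    have h2 : ∀ x : ZMod (p ^ (e + 1)), p • x = 0 ↔ x ∈ AddSubgroup.zmultiples ((p ^ e : ℕ) : ZMod (p ^ (e + 1))) := by
      intro x
      constructor
      · intro h
        have h3 : ((p * x.val : ℕ) : ZMod (p ^ (e + 1))) = 0 := by
          rw [nsmul_eq_mul] at h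
          simpa using h
        rw [ZMod.natCast_eq_zero_iff] at h3
        have h4 : p * p ^ e ∣ p * x.val := by
          have h5 : p * p ^ e = p ^ (e + 1) := by rw [pow_succ, mul_comm]
          rw [h5]; exact h3
        obtain ⟨c, hc⟩ := Nat.dvd_of_mul_dvd_mul_left hp h4
        refine AddSubgroup.mem_zmultiples_iff.2 ⟨c, ?_⟩
        rw [← ZMod.natCast_zmod_val x, hc]
        push_cast
        simp [mul_comm]
      · intro h
        obtain ⟨c, hc⟩ := AddSubgroup.mem_zmultiples_iff.1 h
        rw [← hc, smul_comm]
        have : p • ((p ^ e : ℕ) : ZMod (p ^ (e + 1))) = ((p ^ (e + 1) : ℕ) : ZMod (p ^ (e + 1))) := by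
          rw [nsmul_eq_mul, ← Nat.cast_mul, pow_succ, mul_comm]
        rw [this, ZMod.natCast_self, smul_zero]
    rw [Nat.card_congr (Equiv.subtypeEquivRight h2)]
    erw [Nat.card_zmultiples]
    rw [ZMod.addOrderOf_coe _ (by positivity)]
    rw [Nat.gcd_eq_right (by rw [pow_succ]; exact dvd_mul_right _ _), pow_succ,
      Nat.mul_div_cancel_left _ (by positivity)]
  have e : {x : Fin n → ZMod (p ^ (e + 1)) // p • x = 0} ≃ (Fin n → {x : ZMod (p ^ (e + 1)) // p • x = 0}) :=
    (Equiv.subtypeEquivRight (fun x => by rw [funext_iff]; rfl)).trans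
      (Equiv.subtypePiEquivPi (p := fun _ (x : ZMod (p ^ (e + 1))) => p • x = 0))
  rw [Nat.card_congr e, Nat.card_fun, h1]; simp

/-- divisible-type finite target for extending functionals -/
theorem exists_T (p L : ℕ) [Fact p.Prime] (hL : 1 ≤ L) : ∃ (T : Type) (_ : AddCommGroup T) (_ : Finite T)
    (_ : Module (ZMod (p ^ L)) T) (ι : ZMod p →+ T), Function.Injective ι ∧
    ∀ (n : ℕ) (N : AddSubgroup (Fin n → ZMod (p ^ L))) (f : N →+ ZMod p),
      ∃ t : Fin n → T, ∀ x : N, ∑ i, (x : Fin n → ZMod (p ^ L)) i • t i = ι (f x) := by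
  have hp : 0 < p := (Fact.out : p.Prime).pos
  have : NeZero (p ^ L) := ⟨by positivity⟩
  let C := AddCircle (1 : ℚ)
  let T : AddSubgroup C := (nsmulAddMonoidHom (α := C) (p ^ L)).ker
  have hT : ∀ x : T, (p ^ L) • x = 0 := fun x => Subtype.ext x.2
  have hfin : Finite T := (AddCircle.finite_torsion (1 : ℚ) (n := p ^ L) (by positivity)).to_subtype
  let _ : Module (ZMod (p ^ L)) T := AddCommGroup.zmodModule hT
  let ι₀ : ℤ →+ C := zmultiplesHom C ((1 / p : ℚ) : C)
  have hι₀ : ∀ m : ℤ, ι₀ m = ((m / p : ℚ) : C) := by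
    intro m
    simp only [ι₀, zmultiplesHom_apply]
    rw [← AddCircle.coe_zsmul]
    congr 1; simp; ring
  have hιp : ι₀ p = 0 := by
    rw [hι₀]
    apply (AddCircle.coe_eq_zero_iff _).2 ⟨1, _⟩
    field_simp; simp
  let ι₁ : ZMod p →+ C := ZMod.lift p ⟨ι₀, hιp⟩
  have hι₁ : Function.Injective ι₁ := by
    refine (ZMod.lift_injective p).2 fun m hm => ?_
    have hm' : ι₀ m = 0 := hm
    rw [hι₀, AddCircle.coe_eq_zero_iff] at hm'
    obtain ⟨c, hc⟩ := hm'
    have hp' : (p : ℚ) ≠ 0 := by positivity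
    have h2 : (m : ℚ) = p * c := by
      rw [eq_div_iff hp'] at hc
      rw [← hc]; simp [mul_comm]
    have h3 : m = p * c := by exact_mod_cast h2
    rw [h3]; simp
  have hmem : ∀ y, ι₁ y ∈ T := by
    intro y
    change (p ^ L) • ι₁ y = 0
    rw [← map_nsmul]
    obtain ⟨L', rfl⟩ : ∃ L', L = L' + 1 := ⟨L - 1, by omega⟩
    simp [pow_succ]
  refine ⟨T, inferInstance, hfin, inferInstance, ι₁.codRestrict T hmem, ?_, ?_⟩
  · intro a b hab
    exact hι₁ (congrArg Subtype.val hab)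
  · intro n N f
    obtain ⟨F, hF⟩ := CharacterModule.dual_surjective_of_injective
      (N.subtype.toIntLinearMap) (Subtype.val_injective) (ι₁.comp f)
    let F' : (Fin n → ZMod (p ^ L)) →+ C := F
    have hF' : ∀ x : N, F' x = ι₁ (f x) := fun x => DFunLike.congr_fun hF x
    have htor : ∀ x, F' x ∈ T := by
      intro x
      change (p ^ L) • F' x = 0
      rw [← map_nsmul]
      have : (p ^ L) • x = 0 := by ext i; simp
      rw [this, map_zero]
    refine ⟨fun i => ⟨F' (Pi.single i 1), htor _⟩, fun x => ?_⟩
    apply Subtype.ext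
    change _ = ι₁ (f x)
    rw [← hF']
    have hx : (x : Fin n → ZMod (p ^ L)) = ∑ i, ((x : Fin n → ZMod (p ^ L)) i).val • Pi.single i (1 : ZMod (p ^ L)) := by
      ext j
      rw [Finset.sum_apply, Finset.sum_eq_single j]
      · rw [Pi.smul_apply, Pi.single_eq_same, nsmul_eq_mul, mul_one, ZMod.natCast_zmod_val]
      · intro b _ hb
        rw [Pi.smul_apply, Pi.single_eq_of_ne hb.symm, smul_zero]
      · simp
    conv_rhs => rw [hx, map_sum]
    rw [AddSubgroup.val_finsetSum]
    refine Finset.sum_congr rfl fun i _ => ?_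
    rw [map_nsmul]
    conv_lhs => rw [← ZMod.natCast_zmod_val ((x : Fin n → ZMod (p ^ L)) i)]
    rw [Nat.cast_smul_eq_nsmul]
    rfl

end CokUniv


namespace CokUniv
open scoped Classical

/-- common kernel of functionals on a subgroup -/
def Nf {p : ℕ} {W : Type*} [AddCommGroup W] (N : AddSubgroup W) {k : ℕ} (f : Fin k → (N →+ ZMod p)) :
    Set W := {x | ∃ h : x ∈ N, ∀ i, f i ⟨x, h⟩ = 0}

/-- linearly independent tuples -/
noncomputable def LI (p : ℕ) [Fact p.Prime] (N : Type*) [AddCommGroup N] [Finite N] (k : ℕ) :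
    Finset (Fin k → (N →+ ZMod p)) := Finset.univ.filter (fun f => LinearIndependent (ZMod p) f)

theorem bonf_count (p L : ℕ) [Fact p.Prime] {W : Type*} [AddCommGroup W] [Finite W]
    (hW : ∀ x : W, (p ^ L) • x = 0) (N : AddSubgroup W) {n : ℕ} (c : Fin n → W) (hc : ∀ l, c l ∈ N) :
    ∃ r : ℕ, (∀ k, ∑ f ∈ LI p N k, (if ∀ l, c l ∈ Nf N f then (1 : ℝ) else 0) = fall p r k) ∧
      (r = 0 ↔ AddSubgroup.closure (Set.range c) = N) := by
  let U : Submodule (ZMod p) (N →+ ZMod p) :=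
    { carrier := {f | ∀ l, f ⟨c l, hc l⟩ = 0}
      add_mem' := by intro a b ha hb l; simp [ha l, hb l]
      zero_mem' := by intro l; simp
      smul_mem' := by intro t a ha l; simp [ha l] }
  have hU : ∀ f, f ∈ U ↔ ∀ l, f ⟨c l, hc l⟩ = 0 := fun f => Iff.rfl
  refine ⟨Module.finrank (ZMod p) U, fun k => ?_, ?_⟩
  · have : Finite U := inferInstance
    rw [← card_li p U k]
    rw [Finset.sum_boole, ← Fintype.card_coe, ← Nat.card_eq_fintype_card]
    congr 1
    refine Nat.card_congr
      { toFun := fun f => ⟨fun i => ⟨f.1 i, ?_⟩, ?_⟩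
        invFun := fun s => ⟨fun i => (s.1 i : N →+ ZMod p), ?_⟩
        left_inv := fun f => rfl
        right_inv := fun f => rfl }
    · have := (Finset.mem_filter.1 f.2).2
      intro l
      obtain ⟨_, h⟩ := this l
      exact h i
    · have := (Finset.mem_filter.1 (Finset.mem_filter.1 f.2).1).2
      exact LinearIndependent.of_comp U.subtype (v := fun i => (⟨f.1 i, _⟩ : U)) this
    · refine Finset.mem_filter.2 ⟨Finset.mem_filter.2 ⟨Finset.mem_univ _, ?_⟩, ?_⟩
      · exact s.2.map' U.subtype (by simp)
      · intro l
        exact ⟨hc l, fun i => (s.1 i).2 l⟩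
  · rw [Submodule.finrank_eq_zero]
    have hle : AddSubgroup.closure (Set.range c) ≤ N := by
      rw [AddSubgroup.closure_le]; rintro _ ⟨l, rfl⟩; exact hc l
    constructor
    · intro hbot
      by_contra hne
      let K : AddSubgroup N := (AddSubgroup.closure (Set.range c)).addSubgroupOf N
      have hK : K ≠ ⊤ := by
        intro h
        exact hne (le_antisymm hle (AddSubgroup.addSubgroupOf_eq_top.1 h))
      obtain ⟨f, hf0, hf⟩ := exists_hom p L N (fun x => Subtype.ext (hW x)) K hK
      have : f ∈ U := by
        intro l
        exact hf _ (AddSubgroup.mem_addSubgroupOf.2 (AddSubgroup.subset_closure ⟨l, rfl⟩))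
      rw [hbot, Submodule.mem_bot] at this
      exact hf0 this
    · intro heq
      rw [eq_bot_iff]
      intro f hf
      rw [Submodule.mem_bot]
      ext ⟨x, hx⟩
      have hx' : x ∈ AddSubgroup.closure (Set.range c) := by rw [heq]; exact hx
      have : AddSubgroup.closure (Set.range c) ≤ f.ker.map N.subtype := by
        rw [AddSubgroup.closure_le]
        rintro _ ⟨l, rfl⟩
        exact ⟨⟨c l, hc l⟩, hf l, rfl⟩
      obtain ⟨y, hy, hyx⟩ := this hx'
      have : y = ⟨x, hx⟩ := Subtype.ext hyx
      rw [← this]; exact hy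

theorem bonf_count_zero (p : ℕ) [Fact p.Prime] {W : Type*} [AddCommGroup W] [Finite W]
    (N : AddSubgroup W) {n : ℕ} (c : Fin n → W) (hc : ¬ ∀ l, c l ∈ N) :
    (∀ k, ∑ f ∈ LI p N k, (if ∀ l, c l ∈ Nf N f then (1 : ℝ) else 0) = 0) ∧
      ¬ (AddSubgroup.closure (Set.range c) = N) := by
  constructor
  · intro k
    refine Finset.sum_eq_zero fun f _ => ?_
    rw [if_neg]
    intro h
    exact hc fun l => (h l).1
  · intro h
    apply hc
    intro l
    rw [← h]; exact AddSubgroup.subset_closure ⟨l, rfl⟩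

theorem bonf_pt (p L : ℕ) [Fact p.Prime] {W : Type*} [AddCommGroup W] [Finite W]
    (hW : ∀ x : W, (p ^ L) • x = 0) (N : AddSubgroup W) {n : ℕ} (c : Fin n → W) (J : ℕ) :
    (if AddSubgroup.closure (Set.range c) = N then (1 : ℝ) else 0) ≤
      ∑ k ∈ Finset.range (2 * J + 1), aq p k *
        ∑ f ∈ LI p N k, (if ∀ l, c l ∈ Nf N f then (1 : ℝ) else 0) ∧
    ∑ k ∈ Finset.range (2 * J + 1 + 1), aq p k *
        ∑ f ∈ LI p N k, (if ∀ l, c l ∈ Nf N f then (1 : ℝ) else 0) ≤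
      (if AddSubgroup.closure (Set.range c) = N then (1 : ℝ) else 0) := by
  have hq : (1 : ℝ) < p := by exact_mod_cast (Fact.out : p.Prime).one_lt
  by_cases hc : ∀ l, c l ∈ N
  · obtain ⟨r, h1, h2⟩ := bonf_count p L hW N c hc
    simp only [h1, ← h2]
    exact ⟨bonf_upper hq r J, bonf_lower hq r J⟩
  · obtain ⟨h1, h2⟩ := bonf_count_zero p N c hc
    simp [h1, h2]

/-- expected number of pairs -/
noncomputable def Ek {p L n : ℕ} [Fact p.Prime] [NeZero (p ^ L)] (w : Fin n → Fin n → ZMod (p ^ L) → ℝ)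
    (N : AddSubgroup (Fin n → ZMod (p ^ L))) (k : ℕ) : ℝ :=
  ∑ f ∈ LI p N k, ∏ l, colP w l (Nf N f)

theorem matP_lin_aux {p L n : ℕ} [Fact p.Prime] [NeZero (p ^ L)] (w : Fin n → Fin n → ZMod (p ^ L) → ℝ)
    (N : AddSubgroup (Fin n → ZMod (p ^ L))) (m : ℕ) :
    ∑ k ∈ Finset.range m, aq p k * Ek w N k =
    ∑ A : Fin n → Fin n → ZMod (p ^ L), (∏ k, ∏ l, w k l (A k l)) *
      ∑ k ∈ Finset.range m, aq p k *
        ∑ f ∈ LI p N k, (if ∀ l, (fun i => A i l) ∈ Nf N f then (1 : ℝ) else 0) := by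
  simp only [Ek, ← matP_cols, matP, Finset.mul_sum]
  rw [Finset.sum_comm]
  refine Finset.sum_congr rfl fun k _ => ?_
  rw [Finset.sum_comm]
  refine Finset.sum_congr rfl fun f _ => ?_
  refine Finset.sum_congr rfl fun A _ => ?_
  split_ifs <;> simp [mul_comm]

theorem matP_bonf {p L n : ℕ} [Fact p.Prime] [NeZero (p ^ L)] (w : Fin n → Fin n → ZMod (p ^ L) → ℝ)
    (hw : ∀ k l x, 0 ≤ w k l x)
    (N : AddSubgroup (Fin n → ZMod (p ^ L))) (J : ℕ) :
    matP w (fun A => AddSubgroup.closure (Set.range (fun l i => A i l)) = N) ≤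
      ∑ k ∈ Finset.range (2 * J + 1), aq p k * Ek w N k ∧
    ∑ k ∈ Finset.range (2 * J + 1 + 1), aq p k * Ek w N k ≤
    matP w (fun A => AddSubgroup.closure (Set.range (fun l i => A i l)) = N) := by
  have hW : ∀ x : Fin n → ZMod (p ^ L), (p ^ L) • x = 0 := by
    intro x; ext i
    rw [Pi.smul_apply, nsmul_eq_mul, ZMod.natCast_self]; simp
  have hm : matP w (fun A => AddSubgroup.closure (Set.range (fun l i => A i l)) = N) =
      ∑ A : Fin n → Fin n → ZMod (p ^ L), (∏ k, ∏ l, w k l (A k l)) *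
        (if AddSubgroup.closure (Set.range (fun l i => A i l)) = N then (1 : ℝ) else 0) := by
    simp only [matP, mul_ite, mul_one, mul_zero]
  have h0 : ∀ A : Fin n → Fin n → ZMod (p ^ L), 0 ≤ ∏ k, ∏ l, w k l (A k l) := fun A =>
    Finset.prod_nonneg fun k _ => Finset.prod_nonneg fun l _ => hw k l _
  rw [hm, matP_lin_aux, matP_lin_aux]
  exact ⟨Finset.sum_le_sum fun A _ => mul_le_mul_of_nonneg_left
      (bonf_pt p L hW N (fun l i => A i l) J).1 (h0 A),
    Finset.sum_le_sum fun A _ => mul_le_mul_of_nonneg_left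
      (bonf_pt p L hW N (fun l i => A i l) J).2 (h0 A)⟩

end CokUniv


namespace CokUniv
open scoped Classical

section
variable {p L n : ℕ} [Fact p.Prime]

/-- evaluation map -/
noncomputable def Fv {G : Type*} [AddCommGroup G] [Module (ZMod (p ^ L)) G] (v : Fin n → G) :
    (Fin n → ZMod (p ^ L)) →+ G := (Fintype.linearCombination (ZMod (p ^ L)) v).toAddMonoidHom

theorem Fv_apply {G : Type*} [AddCommGroup G] [Module (ZMod (p ^ L)) G] (v : Fin n → G)
    (x : Fin n → ZMod (p ^ L)) : Fv v x = ∑ i, x i • v i := rfl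

/-- its kernel -/
noncomputable def Nv {G : Type*} [AddCommGroup G] [Module (ZMod (p ^ L)) G] (v : Fin n → G) :
    AddSubgroup (Fin n → ZMod (p ^ L)) := (Fv v).ker

theorem mem_Nv {G : Type*} [AddCommGroup G] [Module (ZMod (p ^ L)) G] (v : Fin n → G)
    (x : Fin n → ZMod (p ^ L)) : x ∈ Nv v ↔ ∑ i, x i • v i = 0 := Iff.rfl

theorem closure_eq_span {G : Type*} [AddCommGroup G] [Module (ZMod (p ^ L)) G] (S : Set G) :
    AddSubgroup.closure S = (Submodule.span (ZMod (p ^ L)) S).toAddSubgroup := by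
  apply le_antisymm
  · rw [AddSubgroup.closure_le]; exact Submodule.subset_span
  · have : Submodule.span (ZMod (p ^ L)) S ≤ AddSubgroup.toZModSubmodule (p ^ L) (AddSubgroup.closure S) :=
      Submodule.span_le.2 AddSubgroup.subset_closure
    exact fun x hx => this hx

theorem range_Fv {G : Type*} [AddCommGroup G] [Module (ZMod (p ^ L)) G] (v : Fin n → G) :
    (Fv (p := p) (L := L) v).range = AddSubgroup.closure (Set.range v) := by
  rw [closure_eq_span (p := p) (L := L), ← Fintype.range_linearCombination]
  rfl

theorem card_Fv {G : Type*} [AddCommGroup G] [Module (ZMod (p ^ L)) G] (v : Fin n → G) :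
    Nat.card (Nv (p := p) (L := L) v) * Nat.card (AddSubgroup.closure (Set.range v)) =
      Nat.card (Fin n → ZMod (p ^ L)) := by
  rw [← range_Fv (p := p) (L := L), ← AddSubgroup.index_ker]
  exact AddSubgroup.card_mul_index _

theorem card_joint {N : Type*} [AddCommGroup N] [Finite N] {k : ℕ} (f : Fin k → (N →+ ZMod p))
    (hf : f ∈ LI p N k) : Nat.card {x : N // ∀ i, f i x = 0} * p ^ k = Nat.card N := by
  have hs := li_surj p N k f (Finset.mem_filter.1 hf).2
  let F : N →+ (Fin k → ZMod p) := AddMonoidHom.mk' (fun x i => f i x) (by intro a b; ext i; simp)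
  have h1 : Nat.card F.ker * F.ker.index = Nat.card N := AddSubgroup.card_mul_index _
  rw [AddSubgroup.index_ker, AddMonoidHom.range_eq_top.2 hs, AddSubgroup.card_top, Nat.card_fun] at h1
  rw [← h1]
  congr 1
  · exact Nat.card_congr (Equiv.subtypeEquivRight fun x => by
      rw [AddMonoidHom.mem_ker, funext_iff]; rfl)
  · simp

theorem card_span_g {G U : Type*} [AddCommGroup G] [Module (ZMod (p ^ L)) G]
    [AddCommGroup U] [Module (ZMod (p ^ L)) U] (v : Fin n → G)
    (hv : AddSubgroup.closure (Set.range v) = ⊤) {k : ℕ}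
    (f : Fin k → (Nv (p := p) (L := L) v →+ ZMod p)) (hf : f ∈ LI p (Nv (p := p) (L := L) v) k)
    (g : Fin n → U) (hg : kerS (q := p ^ L) g = Nf (Nv v) f) :
    Nat.card (AddSubgroup.closure (Set.range g)) = Nat.card G * p ^ k := by
  have h1 := card_Fv (p := p) (L := L) v
  rw [hv, AddSubgroup.card_top] at h1
  have h2 := card_Fv (p := p) (L := L) g
  have h3 := card_joint f hf
  have h4 : Nat.card (Nv (p := p) (L := L) g) = Nat.card {x : Nv (p := p) (L := L) v // ∀ i, f i x = 0} := by
    have : ((Nv (p := p) (L := L) g : AddSubgroup _) : Set (Fin n → ZMod (p ^ L))) = Nf (Nv v) f := hg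
    have e1 : (Nv (p := p) (L := L) g) ≃ (Nf (Nv v) f : Set (Fin n → ZMod (p ^ L))) := Equiv.setCongr this
    rw [Nat.card_congr e1]
    exact Nat.card_congr
      { toFun := fun x => ⟨⟨x.1, x.2.1⟩, x.2.2⟩
        invFun := fun x => ⟨x.1.1, x.1.2, x.2⟩
        left_inv := fun x => rfl
        right_inv := fun x => rfl }
  have hpos : 0 < Nat.card (Nv (p := p) (L := L) g) := Nat.card_pos
  rw [← h1, ← h3, ← h4] at h2
  apply Nat.eq_of_mul_eq_mul_left hpos
  rw [h2]; ring

theorem sum_Err (U : Type) [AddCommGroup U] [Module (ZMod (p ^ L)) U] [Fintype U]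
    (w : Fin n → Fin n → ZMod (p ^ L) → ℝ) :
    ∑ g : Fin n → U, |∏ l, colP w l (kerS g) - ((Nat.card (AddSubgroup.closure (Set.range g)) : ℝ) ^ n)⁻¹| ≤
      ∑ G : Submodule (ZMod (p ^ L)) U, Err G w := by
  rw [← Finset.sum_fiberwise (s := Finset.univ)
    (g := fun g : Fin n → U => Submodule.span (ZMod (p ^ L)) (Set.range g))]
  refine Finset.sum_le_sum fun G _ => le_of_eq ?_
  unfold Err
  symm
  refine Finset.sum_bij (fun g _ => fun i => (g i : U)) ?_ ?_ ?_ ?_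
  · intro g hg
    rw [Finset.mem_filter] at hg ⊢
    refine ⟨Finset.mem_univ _, ?_⟩
    have h1 := hg.2
    rw [closure_eq_span (p := p) (L := L)] at h1
    have h2 : Submodule.span (ZMod (p ^ L)) (Set.range g) = ⊤ := by
      rw [eq_top_iff]; intro x _
      have : x ∈ (Submodule.span (ZMod (p ^ L)) (Set.range g)).toAddSubgroup := by rw [h1]; trivial
      exact this
    have h3 : Set.range (fun i => (g i : U)) = G.subtype '' Set.range g := by
      rw [← Set.range_comp]; rfl
    rw [h3, Submodule.span_image, h2, Submodule.map_top, Submodule.range_subtype]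
  · intro g _ g' _ h
    funext i
    exact Subtype.ext (congrFun h i)
  · intro g hg
    rw [Finset.mem_filter] at hg
    have hm : ∀ i, g i ∈ G := fun i => by rw [← hg.2]; exact Submodule.subset_span ⟨i, rfl⟩
    refine ⟨fun i => ⟨g i, hm i⟩, ?_, rfl⟩
    rw [Finset.mem_filter]
    refine ⟨Finset.mem_univ _, ?_⟩
    rw [closure_eq_span (p := p) (L := L)]
    have h3 : Set.range g = G.subtype '' Set.range (fun i => (⟨g i, hm i⟩ : G)) := by
      rw [← Set.range_comp]; rfl
    have h2 := hg.2
    rw [h3, Submodule.span_image] at h2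
    have h4 : Submodule.map G.subtype (Submodule.span (ZMod (p ^ L)) (Set.range (fun i => (⟨g i, hm i⟩ : G)))) =
        Submodule.map G.subtype ⊤ := by
      rw [h2, Submodule.map_top, Submodule.range_subtype]
    rw [Submodule.map_injective_of_injective G.subtype_injective h4]
    rfl
  · intro g hg
    have h1 := (Finset.mem_filter.1 hg).2
    have hk : kerS (q := p ^ L) g = kerS (fun i => (g i : U)) := by
      ext x
      simp only [kerS, Set.mem_ofPred_eq]
      rw [← Submodule.coe_eq_zero]
      simp
    have hcard : Fintype.card G = Nat.card (AddSubgroup.closure (Set.range (fun i => (g i : U)))) := by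
      have h3 : Set.range (fun i => (g i : U)) = G.subtype.toAddMonoidHom '' Set.range g := by
        rw [← Set.range_comp]; rfl
      rw [h3, ← AddMonoidHom.map_closure, h1, ← AddMonoidHom.range_eq_map, ← Nat.card_eq_fintype_card]
      exact Nat.card_congr (AddMonoidHom.ofInjective (f := G.subtype.toAddMonoidHom) G.subtype_injective).toEquiv
    rw [hk, hcard]

end

/-- generating tuples -/
noncomputable def Sur (H : Type) [AddCommGroup H] [Fintype H] (n : ℕ) : Finset (Fin n → H) :=
  Finset.univ.filter (fun v => AddSubgroup.closure (Set.range v) = ⊤)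

theorem pair_map (p L : ℕ) [Fact p.Prime] (H : Type) [AddCommGroup H]
    [Module (ZMod (p ^ L)) H] (k n : ℕ) (T : Type) [AddCommGroup T] [Module (ZMod (p ^ L)) T]
    (ι : ZMod p →+ T) (hι : Function.Injective ι)
    (t : ∀ (N : AddSubgroup (Fin n → ZMod (p ^ L))) (_ : N →+ ZMod p), Fin n → T)
    (ht : ∀ (N : AddSubgroup (Fin n → ZMod (p ^ L))) (f : N →+ ZMod p), ∀ x : N,
      ∑ i, (x : Fin n → ZMod (p ^ L)) i • t N f i = ι (f x)) :
    ∃ Φ : (Σ v : Fin n → H, Fin k → (Nv (p := p) (L := L) v →+ ZMod p)) → (Fin n → H × (Fin k → T)),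
      Function.Injective Φ ∧ ∀ d, kerS (q := p ^ L) (Φ d) = Nf (Nv d.1) d.2 := by
  let Φ : (Σ v : Fin n → H, Fin k → (Nv (p := p) (L := L) v →+ ZMod p)) → (Fin n → H × (Fin k → T)) :=
    fun d i => (d.1 i, fun j => t _ (d.2 j) i)
  have hΦ2 : ∀ d : (Σ v : Fin n → H, Fin k → (Nv (p := p) (L := L) v →+ ZMod p)), ∀ x : Nv (p := p) (L := L) d.1, ∀ j,
      (∑ i, (x : Fin n → ZMod (p ^ L)) i • Φ d i).2 j = ι (d.2 j x) := by
    intro d x j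
    have h := ht (Nv d.1) (d.2 j) x
    rw [← h]
    rw [Prod.snd_sum, Finset.sum_apply]
    refine Finset.sum_congr rfl fun i _ => ?_
    rw [Prod.smul_snd, Pi.smul_apply]
  have hΦ1 : ∀ d : (Σ v : Fin n → H, Fin k → (Nv (p := p) (L := L) v →+ ZMod p)), ∀ x : Fin n → ZMod (p ^ L),
      (∑ i, x i • Φ d i).1 = ∑ i, x i • d.1 i := by
    intro d x
    simp only [Φ, Prod.fst_sum, Prod.smul_fst]
  have hker : ∀ d : (Σ v : Fin n → H, Fin k → (Nv (p := p) (L := L) v →+ ZMod p)), kerS (q := p ^ L) (Φ d) = Nf (Nv d.1) d.2 := by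
    intro d
    ext x
    constructor
    · intro hx
      have hx' : ∑ i, x i • Φ d i = 0 := hx
      have hm : x ∈ Nv (p := p) (L := L) d.1 := by
        rw [mem_Nv, ← hΦ1, hx']; rfl
      refine ⟨hm, fun j => ?_⟩
      apply hι
      rw [← hΦ2 d ⟨x, hm⟩ j, map_zero]
      change (∑ i, x i • Φ d i).2 j = 0
      rw [hx']; rfl
    · rintro ⟨hm, hj⟩
      change ∑ i, x i • Φ d i = 0
      refine Prod.ext ?_ ?_
      · rw [hΦ1]; exact hm
      · funext j
        have := hΦ2 d ⟨x, hm⟩ j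
        rw [hj j, map_zero] at this
        exact this
  have hinj : Function.Injective Φ := by
    rintro ⟨v, f⟩ ⟨v', f'⟩ h
    have hv : v = v' := by
      funext i
      exact congrArg Prod.fst (congrFun h i)
    subst hv
    have hf : f = f' := by
      funext j
      refine AddMonoidHom.ext fun x => ?_
      apply hι
      refine (ht (Nv v) (f j) x).symm.trans (Eq.trans ?_ (ht (Nv v) (f' j) x))
      refine Finset.sum_congr rfl fun i _ => ?_
      have h1 : t _ (f j) i = t _ (f' j) i := congrFun (congrArg Prod.snd (congrFun h i)) j
      rw [h1]
    rw [hf]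
  exact ⟨Φ, hinj, hker⟩

theorem pair_err (p L : ℕ) [Fact p.Prime] (hL : 1 ≤ L) (H : Type) [AddCommGroup H]
    [Module (ZMod (p ^ L)) H] [Fintype H] (k : ℕ) :
    ∃ (U : Type) (_ : AddCommGroup U) (_ : Module (ZMod (p ^ L)) U) (_ : Fintype U),
    ∀ (n : ℕ) (w : Fin n → Fin n → ZMod (p ^ L) → ℝ),
    ∑ v ∈ Sur H n, ∑ f ∈ LI p (Nv (p := p) (L := L) v) k,
      |∏ l, colP w l (Nf (Nv v) f) - (((Nat.card H * p ^ k : ℕ) : ℝ) ^ n)⁻¹| ≤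
      ∑ G : Submodule (ZMod (p ^ L)) U, Err G w := by
  obtain ⟨T, _, _, _, ι, hι, hext⟩ := exists_T p L hL
  have : Fintype T := Fintype.ofFinite T
  refine ⟨H × (Fin k → T), inferInstance, inferInstance, inferInstance, fun n w => ?_⟩
  refine le_trans ?_ (sum_Err _ w)
  choose t ht using hext n
  obtain ⟨Φ, hinj, hker⟩ := pair_map p L H k n T ι hι t ht
  rw [Finset.sum_sigma']
  calc _ = ∑ d ∈ (Sur H n).sigma (fun v => LI p (Nv (p := p) (L := L) v) k),
        |∏ l, colP w l (kerS (Φ d)) - ((Nat.card (AddSubgroup.closure (Set.range (Φ d))) : ℝ) ^ n)⁻¹| := by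
        refine Finset.sum_congr rfl fun d hd => ?_
        rw [Finset.mem_sigma] at hd
        rw [hker, card_span_g d.1 (Finset.mem_filter.1 hd.1).2 d.2 hd.2 (Φ d) (hker d)]
    _ = ∑ g ∈ ((Sur H n).sigma (fun v => LI p (Nv (p := p) (L := L) v) k)).image Φ,
        |∏ l, colP w l (kerS g) - ((Nat.card (AddSubgroup.closure (Set.range g)) : ℝ) ^ n)⁻¹| := by
        rw [Finset.sum_image (fun a _ b _ h => hinj h)]
    _ ≤ _ := Finset.sum_le_sum_of_subset_of_nonneg (Finset.subset_univ _) (fun _ _ _ => abs_nonneg _)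

theorem pair_err_tendsto (p L : ℕ) [Fact p.Prime] (hL : 1 ≤ L) (H : Type) [AddCommGroup H]
    [Module (ZMod (p ^ L)) H] [Fintype H] (k : ℕ) (α : ℕ → ℝ) (hα : ∀ n, 0 < α n)
    (hαlog : ∀ Δ : ℝ, 0 < Δ → ∀ᶠ n : ℕ in atTop, Δ * Real.log n / n ≤ α n)
    (w : ∀ n : ℕ, Fin n → Fin n → ZMod (p ^ L) → ℝ) (hw : ∀ n, Adm p L (w n) (α n)) :
    Tendsto (fun n => ∑ v ∈ Sur H n, ∑ f ∈ LI p (Nv (p := p) (L := L) v) k,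
      |∏ l, colP (w n) l (Nf (Nv v) f) - (((Nat.card H * p ^ k : ℕ) : ℝ) ^ n)⁻¹|) atTop (nhds 0) := by
  obtain ⟨U, _, _, _, h⟩ := pair_err p L hL H k
  refine squeeze_zero (fun n => Finset.sum_nonneg fun _ _ => Finset.sum_nonneg fun _ _ => abs_nonneg _)
    (fun n => h n (w n)) ?_
  rw [show (0 : ℝ) = ∑ G : Submodule (ZMod (p ^ L)) U, 0 by simp]
  exact tendsto_finsetSum _ fun G _ => Err_tendsto p L G α hα hαlog w hw

theorem card_LI (p e : ℕ) [Fact p.Prime] (H : Type) [AddCommGroup H]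
    [Module (ZMod (p ^ (e + 1))) H] (he : ∀ h : H, (p ^ e) • h = 0) (n : ℕ) (v : Fin n → H) (k : ℕ) :
    ((LI p (Nv (p := p) (L := e + 1) v) k).card : ℝ) = fall p n k := by
  have hp : 0 < p := (Fact.out : p.Prime).pos
  have h1 : Nat.card (Nv (p := p) (L := e + 1) v →+ ZMod p) = p ^ n := by
    rw [card_hom, ← card_tors p e n]
    refine Nat.card_congr
      { toFun := fun x => ⟨x.1.1, congrArg Subtype.val x.2⟩
        invFun := fun x => ⟨⟨x.1, ?_⟩, Subtype.ext x.2⟩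
        left_inv := fun x => rfl
        right_inv := fun x => rfl }
    rw [mem_Nv]
    refine Finset.sum_eq_zero fun i _ => ?_
    have h2 : p • (x.1 i) = 0 := congrFun x.2 i
    have h3 : ((p * (x.1 i).val : ℕ) : ZMod (p ^ (e + 1))) = 0 := by
      rw [nsmul_eq_mul] at h2
      simpa using h2
    rw [ZMod.natCast_eq_zero_iff] at h3
    have h4 : p * p ^ e ∣ p * (x.1 i).val := by
      have h5 : p * p ^ e = p ^ (e + 1) := by rw [pow_succ, mul_comm]
      rw [h5]; exact h3
    obtain ⟨c, hc⟩ := Nat.dvd_of_mul_dvd_mul_left hp h4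
    rw [← ZMod.natCast_zmod_val (x.1 i), hc, Nat.cast_smul_eq_nsmul, mul_smul, he]
  have h2 : Module.finrank (ZMod p) (Nv (p := p) (L := e + 1) v →+ ZMod p) = n := by
    rw [Module.natCard_eq_pow_finrank (K := ZMod p), Nat.card_zmod] at h1
    exact Nat.pow_right_injective (Fact.out : p.Prime).two_le h1
  have h3 := card_li p (Nv (p := p) (L := e + 1) v →+ ZMod p) k
  rw [h2] at h3
  rw [← h3, LI, ← Fintype.card_subtype, ← Nat.card_eq_fintype_card]

end CokUniv


namespace CokUniv
open scoped Classical

theorem Sur_bound (H : Type) [AddCommGroup H] [Fintype H] (n : ℕ) :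
    1 - (Fintype.card (AddSubgroup H) : ℝ) * (1 / 2) ^ n ≤
      ((Sur H n).card : ℝ) * ((Nat.card H : ℝ) ^ n)⁻¹ := by
  have hpos : (0 : ℝ) < Nat.card H := by exact_mod_cast Nat.card_pos
  set B : Finset (Fin n → H) := (Finset.univ.filter (fun K : AddSubgroup H => K ≠ ⊤)).biUnion
    (fun K => Finset.univ.filter (fun v : Fin n → H => ∀ i, v i ∈ K)) with hB
  have h1 : (Finset.univ : Finset (Fin n → H)) ⊆ Sur H n ∪ B := by
    intro v _
    by_cases hv : AddSubgroup.closure (Set.range v) = ⊤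
    · exact Finset.mem_union_left _ (Finset.mem_filter.2 ⟨Finset.mem_univ _, hv⟩)
    · refine Finset.mem_union_right _ (Finset.mem_biUnion.2 ⟨AddSubgroup.closure (Set.range v), ?_, ?_⟩)
      · exact Finset.mem_filter.2 ⟨Finset.mem_univ _, hv⟩
      · exact Finset.mem_filter.2 ⟨Finset.mem_univ _, fun i => AddSubgroup.subset_closure ⟨i, rfl⟩⟩
  have h2 : (Nat.card H : ℝ) ^ n ≤ (Sur H n).card + B.card := by
    have := (Finset.card_le_card h1).trans (Finset.card_union_le _ _)
    rw [Finset.card_univ, Fintype.card_fun, Fintype.card_fin] at this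
    rw [Nat.card_eq_fintype_card]
    exact_mod_cast this
  have h3 : (B.card : ℝ) ≤ Fintype.card (AddSubgroup H) * ((Nat.card H : ℝ) / 2) ^ n := by
    calc (B.card : ℝ) ≤ ∑ K ∈ Finset.univ.filter (fun K : AddSubgroup H => K ≠ ⊤),
          ((Finset.univ.filter (fun v : Fin n → H => ∀ i, v i ∈ K)).card : ℝ) := by
          exact_mod_cast Finset.card_biUnion_le
      _ ≤ ∑ K ∈ Finset.univ.filter (fun K : AddSubgroup H => K ≠ ⊤), ((Nat.card H : ℝ) / 2) ^ n := by
          refine Finset.sum_le_sum fun K hK => ?_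
          have hK' := (Finset.mem_filter.1 hK).2
          have h4 : (Finset.univ.filter (fun v : Fin n → H => ∀ i, v i ∈ K)).card = Nat.card K ^ n := by
            rw [← Fintype.card_subtype, ← Nat.card_eq_fintype_card,
              Nat.card_congr (Equiv.subtypePiEquivPi (p := fun _ (x : H) => x ∈ K))]
            rw [Nat.card_fun]; simp
          rw [h4]
          push_cast
          apply pow_le_pow_left₀ (by positivity)
          have h5 : Nat.card K * K.index = Nat.card H := AddSubgroup.card_mul_index K
          have h6 : 2 ≤ K.index := by
            have h7 : K.index ≠ 0 := AddSubgroup.index_ne_zero_of_finite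
            have h8 : K.index ≠ 1 := fun h => hK' (AddSubgroup.index_eq_one.1 h)
            omega
          rw [le_div_iff₀ two_pos]
          have : Nat.card K * 2 ≤ Nat.card H := by rw [← h5]; exact Nat.mul_le_mul_left _ h6
          exact_mod_cast this
      _ ≤ _ := by
          rw [Finset.sum_const, nsmul_eq_mul]
          apply mul_le_mul_of_nonneg_right _ (by positivity)
          exact_mod_cast Finset.card_le_univ _
  rw [← div_eq_mul_inv, le_div_iff₀ (by positivity)]
  have h9 : ((1 : ℝ) / 2) ^ n * (Nat.card H : ℝ) ^ n = ((Nat.card H : ℝ) / 2) ^ n := by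
    rw [← mul_pow]; congr 1; ring
  rw [sub_mul, one_mul, mul_assoc, h9]
  linarith

theorem Sur_tendsto (H : Type) [AddCommGroup H] [Fintype H] :
    Tendsto (fun n => ((Sur H n).card : ℝ) * ((Nat.card H : ℝ) ^ n)⁻¹) atTop (nhds 1) := by
  have hpos : (0 : ℝ) < Nat.card H := by exact_mod_cast Nat.card_pos
  have h1 : Tendsto (fun n : ℕ => 1 - (Fintype.card (AddSubgroup H) : ℝ) * (1 / 2) ^ n) atTop (nhds 1) := by
    have := (tendsto_pow_atTop_nhds_zero_of_lt_one (r := (1 / 2 : ℝ)) (by norm_num) (by norm_num)).const_mul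
      (Fintype.card (AddSubgroup H) : ℝ)
    simpa using this.const_sub 1
  refine tendsto_of_tendsto_of_tendsto_of_le_of_le h1 tendsto_const_nhds (fun n => Sur_bound H n) ?_
  intro n
  change ((Sur H n).card : ℝ) * ((Nat.card H : ℝ) ^ n)⁻¹ ≤ (1 : ℝ)
  rw [← div_eq_mul_inv, div_le_one (by positivity)]
  have : (Sur H n).card ≤ Nat.card H ^ n := by
    refine (Finset.card_le_univ _).trans ?_
    rw [Fintype.card_fun, Fintype.card_fin, Nat.card_eq_fintype_card]
  exact_mod_cast this

theorem Sk_tendsto (p e : ℕ) [Fact p.Prime] (H : Type) [AddCommGroup H]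
    [Module (ZMod (p ^ (e + 1))) H] [Fintype H] (he : ∀ h : H, (p ^ e) • h = 0)
    (k : ℕ) (α : ℕ → ℝ) (hα : ∀ n, 0 < α n)
    (hαlog : ∀ Δ : ℝ, 0 < Δ → ∀ᶠ n : ℕ in atTop, Δ * Real.log n / n ≤ α n)
    (w : ∀ n : ℕ, Fin n → Fin n → ZMod (p ^ (e + 1)) → ℝ) (hw : ∀ n, Adm p (e + 1) (w n) (α n)) :
    Tendsto (fun n => ∑ v ∈ Sur H n, Ek (w n) (Nv v) k) atTop (nhds 1) := by
  have hp : (1 : ℝ) < p := by exact_mod_cast (Fact.out : p.Prime).one_lt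
  have h0 := pair_err_tendsto p (e + 1) (by omega) H k α hα hαlog w hw
  have h1 : Tendsto (fun n => ((Sur H n).card : ℝ) * ((Nat.card H : ℝ) ^ n)⁻¹ *
      (fall p n k * (((p : ℝ) ^ n) ^ k)⁻¹)) atTop (nhds 1) := by
    simpa using (Sur_tendsto H).mul (fall_ratio_tendsto hp k)
  have h2 : ∀ n, ((Sur H n).card : ℝ) * ((Nat.card H : ℝ) ^ n)⁻¹ * (fall p n k * (((p : ℝ) ^ n) ^ k)⁻¹) =
      ∑ v ∈ Sur H n, ∑ f ∈ LI p (Nv (p := p) (L := e + 1) v) k, (((Nat.card H * p ^ k : ℕ) : ℝ) ^ n)⁻¹ := by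
    intro n
    simp only [Finset.sum_const, nsmul_eq_mul, card_LI p e H he]
    push_cast
    rw [mul_pow, mul_inv, ← pow_mul, ← pow_mul, mul_comm k n]
    ring
  simp only [h2] at h1
  have h3 : Tendsto (fun n => ∑ v ∈ Sur H n, Ek (w n) (Nv v) k -
      ∑ v ∈ Sur H n, ∑ f ∈ LI p (Nv (p := p) (L := e + 1) v) k, (((Nat.card H * p ^ k : ℕ) : ℝ) ^ n)⁻¹)
      atTop (nhds 0) := by
    refine squeeze_zero_norm (fun n => ?_) h0
    rw [Real.norm_eq_abs, ← Finset.sum_sub_distrib]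
    refine (Finset.abs_sum_le_sum_abs _ _).trans (Finset.sum_le_sum fun v _ => ?_)
    rw [Ek, ← Finset.sum_sub_distrib]
    exact Finset.abs_sum_le_sum_abs _ _
  simpa using h3.add h1

theorem X_tendsto (p e : ℕ) [Fact p.Prime] (H : Type) [AddCommGroup H]
    [Module (ZMod (p ^ (e + 1))) H] [Fintype H] (he : ∀ h : H, (p ^ e) • h = 0)
    (α : ℕ → ℝ) (hα : ∀ n, 0 < α n)
    (hαlog : ∀ Δ : ℝ, 0 < Δ → ∀ᶠ n : ℕ in atTop, Δ * Real.log n / n ≤ α n)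
    (w : ∀ n : ℕ, Fin n → Fin n → ZMod (p ^ (e + 1)) → ℝ) (hw : ∀ n, Adm p (e + 1) (w n) (α n)) :
    Tendsto (fun n => ∑ v ∈ Sur H n,
      matP (w n) (fun A => AddSubgroup.closure (Set.range (fun l i => A i l)) = Nv v)) atTop
      (nhds (∏' i : ℕ, (1 - (p : ℝ)⁻¹ ^ (i + 1)))) := by
  have hp : (2 : ℝ) ≤ p := by exact_mod_cast (Fact.out : p.Prime).two_le
  have haq := aq_tendsto hp
  have hS : ∀ m : ℕ, Tendsto (fun n => ∑ k ∈ Finset.range m, aq p k * ∑ v ∈ Sur H n, Ek (w n) (Nv v) k)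
      atTop (nhds (∑ k ∈ Finset.range m, aq p k)) := by
    intro m
    refine tendsto_finsetSum _ fun k _ => ?_
    simpa using (Sk_tendsto p e H he k α hα hαlog w hw).const_mul (aq p k)
  have hsw : ∀ m n : ℕ, ∑ k ∈ Finset.range m, aq p k * ∑ v ∈ Sur H n, Ek (w n) (Nv v) k =
      ∑ v ∈ Sur H n, ∑ k ∈ Finset.range m, aq p k * Ek (w n) (Nv v) k := by
    intro m n
    rw [Finset.sum_comm]
    simp only [Finset.mul_sum]
  have hup : ∀ J n : ℕ, ∑ v ∈ Sur H n,
      matP (w n) (fun A => AddSubgroup.closure (Set.range (fun l i => A i l)) = Nv v) ≤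
      ∑ k ∈ Finset.range (2 * J + 1), aq p k * ∑ v ∈ Sur H n, Ek (w n) (Nv v) k := by
    intro J n
    rw [hsw]
    exact Finset.sum_le_sum fun v _ => (matP_bonf (w n) (hw n).nonneg (Nv v) J).1
  have hlo : ∀ J n : ℕ, ∑ k ∈ Finset.range (2 * J + 1 + 1), aq p k * ∑ v ∈ Sur H n, Ek (w n) (Nv v) k ≤
      ∑ v ∈ Sur H n,
      matP (w n) (fun A => AddSubgroup.closure (Set.range (fun l i => A i l)) = Nv v) := by
    intro J n
    rw [hsw]
    exact Finset.sum_le_sum fun v _ => (matP_bonf (w n) (hw n).nonneg (Nv v) J).2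
  refine tendsto_order.2 ⟨fun a ha => ?_, fun a ha => ?_⟩
  · obtain ⟨m, hm⟩ := ((tendsto_order.1 haq).1 a ha).exists_forall_of_atTop
    have h1 := hm (2 * m + 1 + 1) (by omega)
    filter_upwards [(tendsto_order.1 (hS (2 * m + 1 + 1))).1 a h1] with n hn
    exact hn.trans_le (hlo m n)
  · obtain ⟨m, hm⟩ := ((tendsto_order.1 haq).2 a ha).exists_forall_of_atTop
    have h1 := hm (2 * m + 1) (by omega)
    filter_upwards [(tendsto_order.1 (hS (2 * m + 1))).2 a h1] with n hn
    exact (hup m n).trans_lt hn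

theorem Fv_single {p L n : ℕ} [Fact p.Prime] {H : Type*} [AddCommGroup H] [Module (ZMod (p ^ L)) H]
    (θ : (Fin n → ZMod (p ^ L)) →+ H) : Fv (fun i => θ (Pi.single i 1)) = θ := by
  refine AddMonoidHom.ext fun x => ?_
  have h := LinearMap.pi_apply_eq_sum_univ (θ.toZModLinearMap (p ^ L)) x
  rw [Fv_apply]
  refine Eq.trans ?_ h.symm
  refine Finset.sum_congr rfl fun i _ => ?_
  congr 1
  change θ _ = θ _
  congr 1
  ext j; simp [Pi.single_apply, eq_comm]

theorem card_equivs {p L n : ℕ} [Fact p.Prime] (H : Type) [AddCommGroup H] [Module (ZMod (p ^ L)) H]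
    [Fintype H] (K : AddSubgroup (Fin n → ZMod (p ^ L))) :
    (∑ v ∈ Sur H n, if K = Nv v then (1 : ℝ) else 0) =
      (Nat.card (H ≃+ H) : ℝ) * (if Nonempty (((Fin n → ZMod (p ^ L)) ⧸ K) ≃+ H) then 1 else 0) := by
  have h1 : (∑ v ∈ Sur H n, if K = Nv v then (1 : ℝ) else 0) =
      (Nat.card (((Fin n → ZMod (p ^ L)) ⧸ K) ≃+ H) : ℝ) := by
    rw [Finset.sum_boole, ← Fintype.card_coe, ← Nat.card_eq_fintype_card]
    congr 1
    symm
    have key : ∀ φ : ((Fin n → ZMod (p ^ L)) ⧸ K) ≃+ H,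
        Fv (p := p) (L := L) (fun i => φ (QuotientAddGroup.mk (Pi.single i 1))) =
          (φ : _ →+ H).comp (QuotientAddGroup.mk' K) := fun φ =>
      Fv_single ((φ : _ →+ H).comp (QuotientAddGroup.mk' K))
    refine Nat.card_eq_of_bijective (fun φ => ⟨fun i => φ (QuotientAddGroup.mk (Pi.single i 1)), ?_⟩) ⟨?_, ?_⟩
    · refine Finset.mem_filter.2 ⟨Finset.mem_filter.2 ⟨Finset.mem_univ _, ?_⟩, ?_⟩
      · rw [← range_Fv (p := p) (L := L), key, AddMonoidHom.range_eq_top]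
        exact φ.surjective.comp (QuotientAddGroup.mk'_surjective K)
      · rw [Nv, key]
        ext x
        rw [AddMonoidHom.mem_ker]
        change _ ↔ φ (QuotientAddGroup.mk x) = 0
        rw [map_eq_zero_iff _ φ.injective, QuotientAddGroup.eq_zero_iff]
    · intro φ ψ h
      have h' : (fun i => φ (QuotientAddGroup.mk (Pi.single i 1))) =
        (fun i => ψ (QuotientAddGroup.mk (Pi.single i 1))) := congrArg Subtype.val h
      have h2 := key φ
      rw [h', key ψ] at h2
      refine AddEquiv.ext fun x => ?_
      induction x using QuotientAddGroup.induction_on with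
      | H x => exact (DFunLike.congr_fun h2 x).symm
    · rintro ⟨v, hv⟩
      obtain ⟨hv1, hv2⟩ := Finset.mem_filter.1 hv
      have hv3 := (Finset.mem_filter.1 hv1).2
      have hs : Function.Surjective (Fv (p := p) (L := L) v) := by
        rw [← AddMonoidHom.range_eq_top, range_Fv, hv3]
      refine ⟨(QuotientAddGroup.quotientAddEquivOfEq hv2).trans
        (QuotientAddGroup.quotientKerEquivOfSurjective (Fv v) hs), ?_⟩
      apply Subtype.ext
      funext i
      change Fv (p := p) (L := L) v (Pi.single i 1) = v i
      rw [Fv_apply, Finset.sum_eq_single i]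
      · simp
      · intro b _ hb
        rw [Pi.single_eq_of_ne hb, zero_smul]
      · simp
  rw [h1]
  split_ifs with h
  · obtain ⟨φ⟩ := h
    rw [mul_one]
    congr 1
    refine Nat.card_congr
      { toFun := fun ψ => φ.symm.trans ψ
        invFun := fun ψ => φ.trans ψ
        left_inv := fun ψ => by ext x; simp
        right_inv := fun ψ => by ext x; simp }
  · rw [not_nonempty_iff] at h
    simp

theorem finite_limit (p e : ℕ) [Fact p.Prime] (H : Type) [AddCommGroup H]
    [Module (ZMod (p ^ (e + 1))) H] [Fintype H] (he : ∀ h : H, (p ^ e) • h = 0)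
    (α : ℕ → ℝ) (hα : ∀ n, 0 < α n)
    (hαlog : ∀ Δ : ℝ, 0 < Δ → ∀ᶠ n : ℕ in atTop, Δ * Real.log n / n ≤ α n)
    (w : ∀ n : ℕ, Fin n → Fin n → ZMod (p ^ (e + 1)) → ℝ) (hw : ∀ n, Adm p (e + 1) (w n) (α n)) :
    Tendsto (fun n => matP (w n) (fun A => Nonempty (((Fin n → ZMod (p ^ (e + 1))) ⧸
      AddSubgroup.closure (Set.range (fun l i => A i l))) ≃+ H))) atTop
      (nhds ((Nat.card (H ≃+ H) : ℝ)⁻¹ * ∏' i : ℕ, (1 - (p : ℝ)⁻¹ ^ (i + 1)))) := by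
  have hfin : Finite (H ≃+ H) := Finite.of_injective (fun f : H ≃+ H => (f : H → H)) DFunLike.coe_injective
  have hpos : (0 : ℝ) < Nat.card (H ≃+ H) := by exact_mod_cast Nat.card_pos
  have h1 := (X_tendsto p e H he α hα hαlog w hw).const_mul ((Nat.card (H ≃+ H) : ℝ)⁻¹)
  refine h1.congr fun n => ?_
  rw [inv_mul_eq_iff_eq_mul₀ hpos.ne']
  simp only [matP]
  rw [Finset.sum_comm, Finset.mul_sum]
  refine Finset.sum_congr rfl fun A _ => ?_
  have := card_equivs (p := p) (L := e + 1) H (AddSubgroup.closure (Set.range (fun l i => A i l)))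
  calc _ = (∑ v ∈ Sur H n, if AddSubgroup.closure (Set.range (fun l i => A i l)) = Nv v then (1 : ℝ) else 0)
        * ∏ k, ∏ l, w n k l (A k l) := by
        rw [Finset.sum_mul]
        refine Finset.sum_congr rfl fun v _ => ?_
        split_ifs <;> simp
    _ = _ := by
        rw [this]
        split_ifs <;> simp

end CokUniv


namespace CokUniv
open scoped Classical

section
variable {p : ℕ} [Fact p.Prime]

theorem padic_rep (L : ℕ) (a : ℤ_[p]) : ∃ b : ℤ_[p],
    a = ((PadicInt.toZModPow L a).val : ℤ_[p]) + (p : ℤ_[p]) ^ L * b := by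
  have h : a - ((PadicInt.toZModPow L a).val : ℤ_[p]) ∈ RingHom.ker (PadicInt.toZModPow (p := p) L) := by
    rw [RingHom.mem_ker, map_sub, map_natCast, ZMod.natCast_zmod_val, sub_self]
  rw [PadicInt.ker_toZModPow, Ideal.mem_span_singleton] at h
  obtain ⟨b, hb⟩ := h
  exact ⟨b, by rw [← hb]; ring⟩

theorem add_smul_padic {M H : Type*} [AddCommGroup M] [Module ℤ_[p] M] [AddCommGroup H] [Module ℤ_[p] H]
    (L : ℕ) (hH : ∀ h : H, (p ^ L) • h = 0) (f : M →+ H) (a : ℤ_[p]) (x : M) : f (a • x) = a • f x := by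
  obtain ⟨b, hb⟩ := padic_rep L a
  have hz : ∀ h : H, ((p : ℤ_[p]) ^ L) • h = 0 := by
    intro h
    have := hH h
    rw [← Nat.cast_smul_eq_nsmul ℤ_[p]] at this
    simpa using this
  have hz' : ∀ y : M, f (((p : ℤ_[p]) ^ L) • y) = 0 := by
    intro y
    have h1 : ((p : ℤ_[p]) ^ L) • y = (p ^ L) • y := by
      rw [← Nat.cast_smul_eq_nsmul ℤ_[p]]; simp
    rw [h1, map_nsmul, hH]
  rw [hb, add_smul, add_smul, map_add, mul_smul, mul_smul, hz, hz', Nat.cast_smul_eq_nsmul,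
    Nat.cast_smul_eq_nsmul, map_nsmul]

theorem exists_exp (H : Type*) [AddCommGroup H] [Module ℤ_[p] H] [Finite H] :
    ∃ e : ℕ, ∀ h : H, (p ^ e) • h = 0 := by
  have hp : p.Prime := Fact.out
  obtain ⟨e, m, hm, hc⟩ := Nat.exists_eq_pow_mul_and_not_dvd (n := Nat.card H) Nat.card_pos.ne' p hp.ne_one
  refine ⟨e, fun h => ?_⟩
  have h1 : Nat.card H • h = 0 := card_nsmul_eq_zero'
  rw [hc, mul_comm, mul_smul] at h1
  have hu : IsUnit (m : ℤ_[p]) := by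
    rw [PadicInt.isUnit_iff, PadicInt.norm_natCast_eq_one_iff]
    exact (Nat.Prime.coprime_iff_not_dvd hp).2 hm
  rw [← Nat.cast_smul_eq_nsmul ℤ_[p] m] at h1
  obtain ⟨u, hu'⟩ := hu
  rw [← hu'] at h1
  have h2 : (↑u⁻¹ : ℤ_[p]) • (↑u : ℤ_[p]) • ((p ^ e) • h) = 0 := by rw [h1, smul_zero]
  rwa [smul_smul, Units.inv_mul, one_smul] at h2

theorem card_aut (H : Type*) [AddCommGroup H] [Module ℤ_[p] H] (L : ℕ) (hH : ∀ h : H, (p ^ L) • h = 0) :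
    Nat.card (H ≃ₗ[ℤ_[p]] H) = Nat.card (H ≃+ H) :=
  Nat.card_congr
    { toFun := fun f => f.toAddEquiv
      invFun := fun f => { f with map_smul' := fun a x => add_smul_padic L hH (f : H →+ H) a x }
      left_inv := fun f => rfl
      right_inv := fun f => rfl }

/-- entrywise reduction -/
noncomputable def red (L n : ℕ) : (Fin n → ℤ_[p]) →+ (Fin n → ZMod (p ^ L)) :=
  AddMonoidHom.mk' (fun x i => PadicInt.toZModPow L (x i)) (by intro a b; ext i; simp)

theorem red_apply (L n : ℕ) (x : Fin n → ℤ_[p]) (i : Fin n) :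
    red L n x i = PadicInt.toZModPow L (x i) := rfl

theorem red_surj (L n : ℕ) : Function.Surjective (red (p := p) L n) := by
  intro y
  refine ⟨fun i => ((y i).val : ℤ_[p]), ?_⟩
  ext i
  rw [red_apply, map_natCast, ZMod.natCast_zmod_val]

theorem red_eq_zero (L n : ℕ) (x : Fin n → ℤ_[p]) :
    red L n x = 0 ↔ ∃ y : Fin n → ℤ_[p], x = (p : ℤ_[p]) ^ L • y := by
  constructor
  · intro h
    have h1 : ∀ i, ∃ c, x i = (p : ℤ_[p]) ^ L * c := by
      intro i
      have h2 : x i ∈ RingHom.ker (PadicInt.toZModPow (p := p) L) := congrFun h i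
      rw [PadicInt.ker_toZModPow, Ideal.mem_span_singleton] at h2
      exact h2
    choose y hy using h1
    exact ⟨y, funext hy⟩
  · rintro ⟨y, rfl⟩
    ext i
    have h2 : ((p : ℤ_[p]) ^ L • y) i ∈ RingHom.ker (PadicInt.toZModPow (p := p) L) := by
      rw [PadicInt.ker_toZModPow, Ideal.mem_span_singleton]
      exact ⟨y i, rfl⟩
    exact h2

/-- reduction sends the column space onto the column space -/
theorem red_range (L n : ℕ) (A : Fin n → Fin n → ℤ_[p]) :
    (LinearMap.range (Matrix.mulVecLin (Matrix.of A))).toAddSubgroup.map (red L n) =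
      AddSubgroup.closure (Set.range (fun l i => PadicInt.toZModPow L (A i l))) := by
  apply le_antisymm
  · rintro _ ⟨_, ⟨x, rfl⟩, rfl⟩
    rw [← range_Fv (p := p) (L := L)]
    refine ⟨red L n x, ?_⟩
    rw [Fv_apply]
    ext i
    rw [Finset.sum_apply, red_apply]
    change _ = PadicInt.toZModPow L ((Matrix.of A).mulVec x i)
    simp only [Matrix.mulVec, dotProduct, map_sum, map_mul, Matrix.of_apply, Pi.smul_apply, smul_eq_mul,
      red_apply]
    exact Finset.sum_congr rfl fun l _ => mul_comm _ _
  · rw [AddSubgroup.closure_le]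
    rintro _ ⟨l, rfl⟩
    refine ⟨(Matrix.of A).mulVec (Pi.single l 1), ⟨Pi.single l 1, rfl⟩, ?_⟩
    ext i
    rw [red_apply]
    simp

theorem cok_iff (H : Type*) [AddCommGroup H] [Module ℤ_[p] H] (e : ℕ) (he : ∀ h : H, (p ^ e) • h = 0)
    (n : ℕ) (A : Fin n → Fin n → ℤ_[p]) :
    Nonempty (((Fin n → ℤ_[p]) ⧸ LinearMap.range (Matrix.mulVecLin (Matrix.of A))) ≃ₗ[ℤ_[p]] H) ↔
    Nonempty (((Fin n → ZMod (p ^ (e + 1))) ⧸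
      AddSubgroup.closure (Set.range (fun l i => PadicInt.toZModPow (e + 1) (A i l)))) ≃+ H) := by
  have hL : ∀ h : H, (p ^ (e + 1)) • h = 0 := by
    intro h; rw [pow_succ, mul_comm, mul_smul, he, smul_zero]
  have hcast : ∀ (m : ℕ) (M : Type _) [AddCommGroup M] [Module ℤ_[p] M] (x : M), (p : ℤ_[p]) ^ m • x = (p ^ m) • x := by
    intro m M _ _ x
    rw [← Nat.cast_smul_eq_nsmul ℤ_[p]]; simp
  set I := LinearMap.range (Matrix.mulVecLin (Matrix.of A)) with hI
  rw [← red_range]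
  set K := I.toAddSubgroup.map (red (e + 1) n) with hK
  constructor
  · rintro ⟨φ⟩
    let θ : (Fin n → ℤ_[p]) →+ H := (φ.toLinearMap.comp I.mkQ).toAddMonoidHom
    have hθ : ∀ x, θ x = φ (I.mkQ x) := fun x => rfl
    have hker : ∀ x, θ x = 0 ↔ x ∈ I := by
      intro x
      rw [hθ, map_eq_zero_iff _ φ.injective, Submodule.mkQ_apply, Submodule.Quotient.mk_eq_zero]
    have hle : (red (p := p) (e + 1) n).ker ≤ θ.ker := by
      intro x hx
      obtain ⟨y, rfl⟩ := (red_eq_zero (e + 1) n x).1 hx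
      rw [AddMonoidHom.mem_ker, hcast, map_nsmul, hL]
    let θ' := (red (p := p) (e + 1) n).liftOfRightInverse _ (Function.rightInverse_surjInv (red_surj (e + 1) n)) ⟨θ, hle⟩
    have hθ' : ∀ x, θ' (red (e + 1) n x) = θ x := fun x =>
      AddMonoidHom.liftOfRightInverse_comp_apply _ _ _ ⟨θ, hle⟩ x
    have hs : Function.Surjective θ' := by
      intro h
      obtain ⟨x, hx⟩ := (φ.surjective.comp I.mkQ_surjective) h
      exact ⟨red (e + 1) n x, (hθ' x).trans hx⟩
    have hkk : K = θ'.ker := by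
      ext z
      obtain ⟨x, rfl⟩ := red_surj (e + 1) n z
      rw [AddMonoidHom.mem_ker, hθ', hker]
      constructor
      · rintro ⟨y, hy, hyx⟩
        rw [← hker, ← hθ', ← hyx, hθ', hker]
        exact hy
      · intro hx
        exact ⟨x, hx, rfl⟩
    exact ⟨(QuotientAddGroup.quotientAddEquivOfEq hkk).trans
        (QuotientAddGroup.quotientKerEquivOfSurjective θ' hs)⟩
  · rintro ⟨φ⟩
    let θ : (Fin n → ℤ_[p]) →+ H := ((φ : _ →+ H).comp (QuotientAddGroup.mk' K)).comp (red (e + 1) n)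
    have hθ : ∀ x, θ x = φ (QuotientAddGroup.mk (red (e + 1) n x)) := fun x => rfl
    have hker : ∀ x, θ x = 0 ↔ ∃ y ∈ I, ∃ z : Fin n → ℤ_[p], x = y + (p : ℤ_[p]) ^ (e + 1) • z := by
      intro x
      rw [hθ, map_eq_zero_iff _ φ.injective, QuotientAddGroup.eq_zero_iff]
      constructor
      · rintro ⟨y, hy, hyx⟩
        have h1 : red (e + 1) n (x - y) = 0 := by rw [map_sub, hyx, sub_self]
        obtain ⟨z, hz⟩ := (red_eq_zero _ _ _).1 h1
        exact ⟨y, hy, z, by rw [← hz]; abel⟩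
      · rintro ⟨y, hy, z, rfl⟩
        refine ⟨y, hy, ?_⟩
        rw [map_add, (red_eq_zero (e + 1) n _).2 ⟨z, rfl⟩, add_zero]
    let N : Submodule ℤ_[p] (Fin n → ℤ_[p]) :=
      LinearMap.range ((p : ℤ_[p]) ^ e • (LinearMap.id : (Fin n → ℤ_[p]) →ₗ[ℤ_[p]] (Fin n → ℤ_[p])))
    have hNI : N ≤ I := by
      refine Submodule.le_of_le_smul_of_le_jacobson_bot (I := Ideal.span {(p : ℤ_[p])}) ?_ ?_ ?_
      · exact IsNoetherian.noetherian N
      · rw [IsLocalRing.jacobson_eq_maximalIdeal _ bot_ne_top, PadicInt.maximalIdeal_eq_span_p]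
      · rintro _ ⟨x, rfl⟩
        have h1 : θ ((p : ℤ_[p]) ^ e • x) = 0 := by rw [hcast, map_nsmul, he]
        obtain ⟨y, hy, z, hz⟩ := (hker _).1 h1
        change (p : ℤ_[p]) ^ e • x ∈ _
        rw [hz]
        refine Submodule.add_mem_sup hy ?_
        rw [pow_succ', mul_smul]
        exact Submodule.smul_mem_smul (Ideal.mem_span_singleton_self _) ⟨z, rfl⟩
    have hker' : ∀ x, θ x = 0 ↔ x ∈ I := by
      intro x
      rw [hker]
      constructor
      · rintro ⟨y, hy, z, rfl⟩
        refine I.add_mem hy ?_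
        rw [pow_succ', mul_smul]
        exact I.smul_mem _ (hNI ⟨z, rfl⟩)
      · intro hx
        exact ⟨x, hx, 0, by simp⟩
    let Θ : (Fin n → ℤ_[p]) →ₗ[ℤ_[p]] H :=
      { θ with map_smul' := fun a x => add_smul_padic (e + 1) hL θ a x }
    have hs : Function.Surjective Θ :=
      (φ.surjective.comp (QuotientAddGroup.mk'_surjective K)).comp (red_surj (e + 1) n)
    have hk : I = LinearMap.ker Θ := by
      ext x
      rw [LinearMap.mem_ker]
      exact (hker' x).symm
    exact ⟨(Submodule.quotEquivOfEq _ _ hk).trans (Θ.quotKerEquivOfSurjective hs)⟩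

end

section
variable {p : ℕ} [Fact p.Prime] [MeasurableSpace ℤ_[p]] [BorelSpace ℤ_[p]]

theorem meas_fiber (L : ℕ) (x : ZMod (p ^ L)) :
    MeasurableSet ((fun y : ℤ_[p] => PadicInt.toZModPow L y) ⁻¹' {x}) := by
  apply IsOpen.measurableSet
  rw [Metric.isOpen_iff]
  intro y hy
  have hp : (0 : ℝ) < p := by exact_mod_cast (Fact.out : p.Prime).pos
  refine ⟨(p : ℝ) ^ (-(L : ℤ)), by positivity, fun z hz => ?_⟩
  rw [Metric.mem_ball, dist_eq_norm] at hz
  have h1 := (PadicInt.norm_le_pow_iff_mem_span_pow (z - y) L).1 hz.le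
  rw [← PadicInt.ker_toZModPow, RingHom.mem_ker, map_sub, sub_eq_zero] at h1
  exact h1.trans hy

/-- entry weights -/
noncomputable def wt (L n : ℕ) (μ : Fin n → Fin n → Measure ℤ_[p]) (k l : Fin n) (x : ZMod (p ^ L)) : ℝ :=
  (μ k l ((fun y : ℤ_[p] => PadicInt.toZModPow L y) ⁻¹' {x})).toReal

theorem wt_sum (L : ℕ) (ν : Measure ℤ_[p]) [IsProbabilityMeasure ν] (P : ZMod (p ^ L) → Prop) :
    ∑ x, (if P x then (ν ((fun y : ℤ_[p] => PadicInt.toZModPow L y) ⁻¹' {x})).toReal else 0) =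
      (ν {y | P (PadicInt.toZModPow L y)}).toReal := by
  rw [← Finset.sum_filter, ← ENNReal.toReal_sum (fun _ _ => measure_ne_top _ _),
    sum_measure_preimage_singleton _ (fun y _ => meas_fiber L y)]
  congr 2
  ext y
  simp

theorem toZMod_val (L : ℕ) (hL : 1 ≤ L) (y : ℤ_[p]) :
    ((PadicInt.toZModPow L y).val : ZMod p) = PadicInt.toZMod y := by
  obtain ⟨b, hb⟩ := padic_rep L y
  conv_rhs => rw [hb, map_add, map_mul, map_pow, map_natCast, map_natCast]
  simp [show L ≠ 0 by omega]

theorem wt_adm (L n : ℕ) (hL : 1 ≤ L) (μ : Fin n → Fin n → Measure ℤ_[p]) (a : ℝ)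
    (hprob : ∀ k l, IsProbabilityMeasure (μ k l))
    (hbal : ∀ k l (c : ZMod p), μ k l {x : ℤ_[p] | PadicInt.toZMod x = c} ≤ ENNReal.ofReal (1 - a)) :
    Adm p L (wt L n μ) a where
  nonneg := fun k l x => ENNReal.toReal_nonneg
  sum := fun k l => by
    have := hprob k l
    have h := wt_sum L (μ k l) (fun _ => True)
    simpa [wt] using h
  bal := fun k l c => by
    have := hprob k l
    have h := wt_sum L (μ k l) (fun x => (x.val : ZMod p) = c)
    simp only [toZMod_val L hL] at h
    have ha : 0 ≤ 1 - a := by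
      by_contra hneg
      push Not at hneg
      have h0 : ∀ c : ZMod p, μ k l {x : ℤ_[p] | PadicInt.toZMod x = c} = 0 := by
        intro c
        have := hbal k l c
        rw [ENNReal.ofReal_of_nonpos hneg.le] at this
        exact le_antisymm this zero_le
      have h1 : μ k l (⋃ c : ZMod p, {x : ℤ_[p] | PadicInt.toZMod x = c}) = 0 :=
        measure_iUnion_null h0
      have h2 : (⋃ c : ZMod p, {x : ℤ_[p] | PadicInt.toZMod x = c}) = Set.univ := by
        ext x; simp
      rw [h2, measure_univ] at h1
      exact one_ne_zero h1
    have hfin := ENNReal.toReal_le_of_le_ofReal ha (hbal k l c)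
    rw [← h] at hfin
    refine le_trans (le_of_eq ?_) hfin
    refine Finset.sum_congr rfl fun x _ => ?_
    by_cases hx : (x.val : ZMod p) = c <;> simp [hx, wt]

theorem measure_event (L n : ℕ) (μ : Fin n → Fin n → Measure ℤ_[p])
    (hprob : ∀ k l, IsProbabilityMeasure (μ k l)) (E : (Fin n → Fin n → ZMod (p ^ L)) → Prop) :
    ((Measure.pi fun k : Fin n => Measure.pi fun l : Fin n => μ k l)
      {A : Fin n → Fin n → ℤ_[p] | E (fun k l => PadicInt.toZModPow L (A k l))}).toReal =
      matP (wt L n μ) E := by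
  set ν := Measure.pi fun k : Fin n => Measure.pi fun l : Fin n => μ k l with hν
  let f : (Fin n → Fin n → ℤ_[p]) → (Fin n → Fin n → ZMod (p ^ L)) :=
    fun A k l => PadicInt.toZModPow L (A k l)
  have hf : ∀ B, f ⁻¹' {B} = Set.univ.pi (fun k => Set.univ.pi (fun l =>
      (fun y : ℤ_[p] => PadicInt.toZModPow L y) ⁻¹' {B k l})) := by
    intro B
    ext A
    simp [f, funext_iff, Set.mem_pi]
  have hm : ∀ B, MeasurableSet (f ⁻¹' {B}) := by
    intro B
    rw [hf]
    exact MeasurableSet.univ_pi fun k => MeasurableSet.univ_pi fun l => meas_fiber L _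
  have h1 := sum_measure_preimage_singleton (μ := ν) (Finset.univ.filter E) (f := f) (fun y _ => hm y)
  have h2 : f ⁻¹' ((Finset.univ.filter E : Finset _) : Set _) =
      {A : Fin n → Fin n → ℤ_[p] | E (fun k l => PadicInt.toZModPow L (A k l))} := by
    ext A; simp [f]
  have hval : ∀ B, ν (f ⁻¹' {B}) = ∏ k, ∏ l, μ k l ((fun y : ℤ_[p] => PadicInt.toZModPow L y) ⁻¹' {B k l}) := by
    intro B
    rw [hf, hν, Measure.pi_pi]
    refine Finset.prod_congr rfl fun k _ => ?_
    rw [Measure.pi_pi]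
  rw [← h2, ← h1, ENNReal.toReal_sum (fun _ _ => measure_ne_top _ _), Finset.sum_filter, matP]
  refine Finset.sum_congr rfl fun B _ => ?_
  rw [hval, ENNReal.toReal_prod]
  simp only [ENNReal.toReal_prod]
  rfl

end

end CokUniv

theorem stmt_0 (p : ℕ) [Fact p.Prime]
    [MeasurableSpace ℤ_[p]] [BorelSpace ℤ_[p]]
    (H : Type) [AddCommGroup H] [Module ℤ_[p] H] [Finite H]
    (α : ℕ → ℝ) (hα : ∀ n, 0 < α n)
    (hαlog : ∀ Δ : ℝ, 0 < Δ → ∀ᶠ n : ℕ in atTop, Δ * Real.log n / n ≤ α n)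
    (μ : (n : ℕ) → Fin n → Fin n → Measure ℤ_[p])
    (hprob : ∀ n k l, IsProbabilityMeasure (μ n k l))
    (hbal : ∀ n k l (a : ZMod p),
      μ n k l {x : ℤ_[p] | PadicInt.toZMod x = a} ≤ ENNReal.ofReal (1 - α n)) :
    Tendsto (fun n : ℕ =>
      ((Measure.pi fun k : Fin n => Measure.pi fun l : Fin n => μ n k l)
        {A : Fin n → Fin n → ℤ_[p] |
          Nonempty
            (((Fin n → ℤ_[p]) ⧸ LinearMap.range (Matrix.mulVecLin (Matrix.of A)))
              ≃ₗ[ℤ_[p]] H)}).toReal)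
      atTop
      (nhds ((Nat.card (H ≃ₗ[ℤ_[p]] H) : ℝ)⁻¹ * ∏' i : ℕ, (1 - (p : ℝ)⁻¹ ^ (i + 1)))) := by
  obtain ⟨e, he⟩ := CokUniv.exists_exp (p := p) H
  have hL : ∀ h : H, (p ^ (e + 1)) • h = 0 := by
    intro h; rw [pow_succ, mul_comm, mul_smul, he, smul_zero]
  have : Fintype H := Fintype.ofFinite H
  let inst : Module (ZMod (p ^ (e + 1))) H := AddCommGroup.zmodModule hL
  rw [CokUniv.card_aut H (e + 1) hL]
  have h := CokUniv.finite_limit p e H he α hα hαlog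
    (fun n => CokUniv.wt (e + 1) n (μ n))
    (fun n => CokUniv.wt_adm (e + 1) n (by omega) (μ n) (α n) (hprob n) (hbal n))
  refine h.congr fun n => ?_
  rw [← CokUniv.measure_event (e + 1) n (μ n) (hprob n)]
  congr 2
  ext A
  exact (CokUniv.cok_iff H e he n A).symm
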